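/- arXiv:2206.14088 — 10 statements merged into one kernel-verified Lean document; each statement's English description precedes it below -/
import Mathlib

section
/- Let n ≥ 2 be an integer and 1 ≤ k ≤ n-1. For every κ ∈ GL(n,ℂ) with κᵗκ = I_n, every invertible diagonal complex matrix a = diag(a₁,…,a_n), and every lower triangular complex matrix n̄ with unit diagonal, one has f_k(κ a n̄) = (a_{k+1} a_{k+2} ⋯ a_n)². In particular, f_k is nowhere vanishing on the set K_ℂ A_ℂ N̄_ℂ of all such products κ a n̄. -/
open Matrix

/-- `f_k(g)` is the determinant of the bottom-right `(n-k)×(n-k)` submatrix of `gᵀg`. -/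
noncomputable def fk (n k : ℕ) (g : Matrix (Fin n) (Fin n) ℂ) : ℂ :=
  ((gᵀ * g).submatrix
      (fun j : Fin (n - k) => (⟨k + j.val, by omega⟩ : Fin n))
      (fun j : Fin (n - k) => (⟨k + j.val, by omega⟩ : Fin n))).det

/-- If the rows of `N` outside the range of `e` vanish on the columns in that range, then taking
the submatrix along `e` commutes with forming `Nᵀ * diagonal w * N`. -/
theorem submatrix_transpose_mul_diagonal_mul {m ι R : Type*} [Fintype m] [DecidableEq m]
    [Fintype ι] [DecidableEq ι] [CommSemiring R] {e : ι → m} (he : Function.Injective e)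
    (N : Matrix m m R) (w : m → R) (hN : ∀ l ∉ Set.range e, ∀ j, N l (e j) = 0) :
    (Nᵀ * diagonal w * N).submatrix e e =
      (N.submatrix e e)ᵀ * diagonal (w ∘ e) * N.submatrix e e := by
  ext i j
  simp only [submatrix_apply, mul_apply (N := N), mul_apply (N := N.submatrix e e),
    mul_diagonal, transpose_apply]
  refine (Fintype.sum_of_injective e he _ _ (fun l hl => ?_) fun l => rfl).symm
  rw [hN l hl j, mul_zero]

/-- On `K_ℂ A_ℂ N̄_ℂ` one has `f_k(κ a n̄) = (a_{k+1} ⋯ a_n)²`; in particular `f_k` does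
not vanish there. -/
theorem stmt2 (n k : ℕ) (hn : 2 ≤ n) (hk1 : 1 ≤ k) (hk2 : k ≤ n - 1)
    (κ : Matrix (Fin n) (Fin n) ℂ) (hκ : κᵀ * κ = 1)
    (d : Fin n → ℂ) (hd : ∀ i, d i ≠ 0)
    (nbar : Matrix (Fin n) (Fin n) ℂ)
    (hnbar_lower : ∀ i j : Fin n, i < j → nbar i j = 0)
    (hnbar_diag : ∀ i : Fin n, nbar i i = 1) :
    fk n k (κ * Matrix.diagonal d * nbar) =
        (∏ i ∈ Finset.univ.filter (fun i : Fin n => k ≤ i.val), d i) ^ 2 ∧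
      fk n k (κ * Matrix.diagonal d * nbar) ≠ 0 := by
  set e : Fin (n - k) → Fin n := fun j => ⟨k + j.val, by omega⟩ with he_def
  have he : Function.Injective e := fun i j h => by
    simp only [he_def, Fin.mk.injEq] at h
    omega
  have hrange : ∀ l ∉ Set.range e, l.val < k := fun l hl => by
    by_contra! h
    exact hl ⟨⟨l.val - k, by omega⟩, Fin.ext (by simp only [he_def]; omega)⟩
  have hgram : (κ * diagonal d * nbar)ᵀ * (κ * diagonal d * nbar) =
      nbarᵀ * diagonal (fun i => d i * d i) * nbar := by
    calc (κ * diagonal d * nbar)ᵀ * (κ * diagonal d * nbar)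
        = nbarᵀ * (diagonal d * (κᵀ * κ) * diagonal d) * nbar := by
          simp only [transpose_mul, diagonal_transpose, Matrix.mul_assoc]
      _ = _ := by rw [hκ, Matrix.mul_one, diagonal_mul_diagonal]
  have hdet : (nbar.submatrix e e).det = 1 := by
    rw [det_of_isLowerTriangular]
    · simp [hnbar_diag]
    · intro i j hij
      refine hnbar_lower _ _ ?_
      have hij' : i < j := hij
      simp only [he_def, Fin.lt_def] at hij' ⊢
      omega
  have hprod : ∏ j, d (e j) = ∏ i ∈ Finset.univ.filter (fun i : Fin n => k ≤ i.val), d i := by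
    rw [Finset.prod_filter]
    refine Fintype.prod_of_injective e he _ _ (fun l hl => ?_) fun j => ?_
    · exact if_neg (not_le.mpr (hrange l hl))
    · exact (if_pos (Nat.le_add_right k j.val)).symm
  have hmain : fk n k (κ * diagonal d * nbar) =
      (∏ i ∈ Finset.univ.filter (fun i : Fin n => k ≤ i.val), d i) ^ 2 := by
    change (((κ * diagonal d * nbar)ᵀ * (κ * diagonal d * nbar)).submatrix e e).det = _
    rw [hgram, submatrix_transpose_mul_diagonal_mul he, det_mul, det_mul, det_transpose, hdet,
      det_diagonal, one_mul, mul_one, ← hprod, sq, ← Finset.prod_mul_distrib]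
    · rfl
    · intro l hl j
      refine hnbar_lower _ _ ?_
      have hlk := hrange l hl
      simp only [he_def, Fin.lt_def]
      omega
  refine ⟨hmain, ?_⟩
  rw [hmain]
  exact pow_ne_zero 2 (Finset.prod_ne_zero_iff.mpr fun i _ => hd i)
end

section
/- Let k, m ≥ 1 be integers. Let X, Y be real k×m matrices and suppose that I_m − YᵗY is positive definite. Then, with Z := X + iY ∈ Mat_{k×m}(ℂ), one has det(I_m + ZᵗZ) ≠ 0. -/
open Matrix

/-- A complex matrix `A + iB` with `A` real positive definite and `B` real symmetric is
nonsingular. -/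
theorem det_add_I_smul_ne_zero_of_posDef {n : Type*} [Fintype n] [DecidableEq n]
    {A B : Matrix n n ℝ} (hA : A.PosDef) (hB : B.IsSymm) :
    (A.map Complex.ofReal + Complex.I • B.map Complex.ofReal).det ≠ 0 := by
  intro hdet
  obtain ⟨v, hv, hMv⟩ := Matrix.exists_mulVec_eq_zero_iff.mpr hdet
  set a : n → ℝ := fun i => (v i).re with ha
  set b : n → ℝ := fun i => (v i).im with hb
  have hre : A *ᵥ a = B *ᵥ b := by
    ext i
    have h := congrArg Complex.re (congrFun hMv i)
    simp [Matrix.mulVec, dotProduct, add_mul, Finset.sum_add_distrib] at h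
    simp only [Matrix.mulVec, dotProduct, ha, hb]
    linarith
  have him : A *ᵥ b = -(B *ᵥ a) := by
    ext i
    have h := congrArg Complex.im (congrFun hMv i)
    simp [Matrix.mulVec, dotProduct, add_mul, Finset.sum_add_distrib] at h
    simp only [Matrix.mulVec, dotProduct, ha, hb, Pi.neg_apply]
    linarith
  have hsymm : a ⬝ᵥ B *ᵥ b = b ⬝ᵥ B *ᵥ a := by
    rw [dotProduct_mulVec, ← mulVec_transpose, hB.eq, dotProduct_comm]
  have hsum : a ⬝ᵥ A *ᵥ a + b ⬝ᵥ A *ᵥ b = 0 := by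
    rw [hre, him, dotProduct_neg, hsymm, add_neg_cancel]
  have hnonneg (x : n → ℝ) : 0 ≤ x ⬝ᵥ A *ᵥ x := by
    simpa using hA.posSemidef.dotProduct_mulVec_nonneg x
  have hzero (x : n → ℝ) (hx : x ⬝ᵥ A *ᵥ x = 0) : x = 0 := by
    by_contra hne
    have hpos := hA.dotProduct_mulVec_pos hne
    simp only [star_trivial] at hpos
    exact hpos.ne' hx
  have ha0 := hzero a (by linarith [hnonneg a, hnonneg b])
  have hb0 := hzero b (by linarith [hnonneg a, hnonneg b])
  exact hv (funext fun i => Complex.ext (congrFun ha0 i) (congrFun hb0 i))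

/-- If `X, Y` are real `k×m` matrices with `I - YᵀY` positive definite, then for
`Z = X + iY` one has `det(I + ZᵀZ) ≠ 0`. -/
theorem stmt3 (k m : ℕ) (hk : 1 ≤ k) (hm : 1 ≤ m)
    (X Y : Matrix (Fin k) (Fin m) ℝ)
    (hY : (1 - Yᵀ * Y).PosDef) :
    (1 + (X.map (Complex.ofReal) + Complex.I • Y.map (Complex.ofReal))ᵀ *
        (X.map (Complex.ofReal) + Complex.I • Y.map (Complex.ofReal))).det ≠ 0 := by
  have hA : ((1 - Yᵀ * Y) + Xᵀ * X).PosDef :=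
    hY.add_posSemidef (by simpa using posSemidef_conjTranspose_mul_self X)
  have hB : (Xᵀ * Y + Yᵀ * X).IsSymm := by
    simp [Matrix.IsSymm, add_comm]
  convert det_add_I_smul_ne_zero_of_posDef hA hB using 2
  ext i j
  apply Complex.ext <;>
    simp [Matrix.mul_apply, Matrix.one_apply, add_mul, mul_add, Finset.sum_add_distrib,
      apply_ite Complex.re, apply_ite Complex.im] <;>
    ring
end

section
/- Let n ≥ 2 be an integer and s > 0. Let y ∈ ℝⁿ with 0 < |y| < 1 and set γ := √(1−|y|²). Then ∫_{ℝⁿ} (1 + |x|² + 2γ^{-1}|⟨x,y⟩|)^{-(n/2+s)} dx = σ_{n-2} · (∫₀^∞ t^{n-2}(1+t²)^{-(n/2+s)} dt) · (∫_{-∞}^{∞} (1 + u² + 2γ^{-1}|y|·|u|)^{-(s+1/2)} du), where σ_{n-2} denotes the total surface measure of the unit sphere S^{n-2} ⊂ ℝ^{n-1} (with the convention σ₀ = 2 when n = 2). Moreover ∫₀^∞ t^{n-2}(1+t²)^{-(n/2+s)} dt is finite. -/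
open MeasureTheory Real
open scoped RealInnerProductSpace ENNReal

/-- Integration of a radial function in polar coordinates, for the lower Lebesgue integral. -/
theorem lintegral_fun_norm_addHaar {E : Type*} [NormedAddCommGroup E] [NormedSpace ℝ E]
    [FiniteDimensional ℝ E] [Nontrivial E] [MeasurableSpace E] [BorelSpace E]
    (μ : Measure E) [μ.IsAddHaarMeasure] {f : ℝ → ℝ≥0∞} (hf : Measurable f) :
    ∫⁻ x, f ‖x‖ ∂μ = μ.toSphere Set.univ *
      ∫⁻ t in Set.Ioi (0 : ℝ), ENNReal.ofReal (t ^ (Module.finrank ℝ E - 1)) * f t := by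
  calc
    ∫⁻ x, f ‖x‖ ∂μ = ∫⁻ x : ({(0)}ᶜ : Set E), f ‖x.1‖ ∂(μ.comap (↑)) := by
      rw [lintegral_subtype_comap (measurableSet_singleton _).compl fun x ↦ f ‖x‖,
        restrict_compl_singleton]
    _ = ∫⁻ x, f x.2 ∂μ.toSphere.prod (.volumeIoiPow (Module.finrank ℝ E - 1)) := by
      simpa using μ.measurePreserving_homeomorphUnitSphereProd.lintegral_comp_emb
        (Homeomorph.measurableEmbedding _) (f ∘ Subtype.val ∘ Prod.snd)
    _ = μ.toSphere Set.univ *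
        ∫⁻ x : Set.Ioi (0 : ℝ), f x ∂.volumeIoiPow (Module.finrank ℝ E - 1) := by
      rw [lintegral_prod _ (by fun_prop)]
      simp [mul_comm]
    _ = _ := by
      rw [Measure.volumeIoiPow, lintegral_withDensity_eq_lintegral_mul _ (by fun_prop)
        (by fun_prop)]
      congr 1
      exact lintegral_subtype_comap measurableSet_Ioi
        fun t : ℝ ↦ ENNReal.ofReal (t ^ (Module.finrank ℝ E - 1)) * f t

/-- The surface measure of the unit sphere of `ℝ ^ m`. -/
theorem EuclideanSpace.toSphere_univ {m : ℕ} (hm : 0 < m) :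
    (volume : Measure (EuclideanSpace ℝ (Fin m))).toSphere Set.univ =
      ENNReal.ofReal (2 * π ^ ((m : ℝ) / 2) / Gamma ((m : ℝ) / 2)) := by
  have : Nonempty (Fin m) := ⟨⟨0, hm⟩⟩
  have hm' : (0 : ℝ) < m / 2 := by positivity
  have hG := Gamma_pos_of_pos hm'
  rw [Measure.toSphere_apply_univ, EuclideanSpace.volume_ball, finrank_euclideanSpace_fin,
    Fintype.card_fin, ← ENNReal.ofReal_natCast, ENNReal.ofReal_one, one_pow, one_mul,
    ← ENNReal.ofReal_mul (by positivity), Gamma_add_one hm'.ne', sqrt_eq_rpow, ← rpow_natCast,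
    ← rpow_mul pi_pos.le]
  congr 1
  rw [one_div_mul_eq_div]
  field_simp

/-- Scaling of the integral of a power of `A + ‖z‖ ^ 2`. -/
theorem lintegral_add_norm_sq_rpow_neg {E : Type*} [NormedAddCommGroup E] [NormedSpace ℝ E]
    [FiniteDimensional ℝ E] [MeasurableSpace E] [BorelSpace E]
    (μ : Measure E) [μ.IsAddHaarMeasure] {A : ℝ} (hA : 0 < A) (p : ℝ) :
    ∫⁻ z, ENNReal.ofReal ((A + ‖z‖ ^ 2) ^ (-p)) ∂μ =
      ENNReal.ofReal (A ^ ((Module.finrank ℝ E : ℝ) / 2 - p)) *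
        ∫⁻ z, ENNReal.ofReal ((1 + ‖z‖ ^ 2) ^ (-p)) ∂μ := by
  have hr : 0 < √A := sqrt_pos.2 hA
  have key (z : E) : ENNReal.ofReal ((A + ‖z‖ ^ 2) ^ (-p)) = ENNReal.ofReal (A ^ (-p)) *
      ENNReal.ofReal ((1 + ‖(√A)⁻¹ • z‖ ^ 2) ^ (-p)) := by
    rw [← ENNReal.ofReal_mul (by positivity), ← mul_rpow hA.le (by positivity), norm_smul,
      norm_inv, norm_of_nonneg hr.le, mul_pow, inv_pow, sq_sqrt hA.le]
    congr 2
    field_simp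
  have hmeas : Measurable fun z : E ↦ ENNReal.ofReal ((1 + ‖z‖ ^ 2) ^ (-p)) := by fun_prop
  simp_rw [key]
  rw [lintegral_const_mul _ (by fun_prop),
    ← lintegral_map hmeas (measurable_const_smul (√A)⁻¹),
    Measure.map_addHaar_smul μ (inv_ne_zero hr.ne'), lintegral_smul_measure, smul_eq_mul,
    ← mul_assoc, ← ENNReal.ofReal_mul (by positivity)]
  congr 2
  rw [inv_pow, inv_inv, abs_of_pos (by positivity), sqrt_eq_rpow, ← rpow_natCast,
    ← rpow_mul hA.le, ← rpow_add hA]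
  congr 1
  ring

/-- Fubini along the line spanned by a nonzero vector `y`: an integral of a function of `‖x‖ ^ 2`
and `⟪x, y⟫` over `ℝ ^ (m + 1)` is an iterated integral over `ℝ` and `ℝ ^ m`. -/
theorem EuclideanSpace.lintegral_norm_sq_inner {m : ℕ} {y : EuclideanSpace ℝ (Fin (m + 1))}
    (hy : y ≠ 0) {F : ℝ → ℝ → ℝ≥0∞} (hF : Measurable (Function.uncurry F)) :
    ∫⁻ x : EuclideanSpace ℝ (Fin (m + 1)), F (‖x‖ ^ 2) ⟪x, y⟫ =
      ∫⁻ u : ℝ, ∫⁻ z : EuclideanSpace ℝ (Fin m), F (u ^ 2 + ‖z‖ ^ 2) (‖y‖ * u) := by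
  have hy' : ‖y‖ ≠ 0 := norm_ne_zero_iff.2 hy
  obtain ⟨b, hb⟩ : ∃ b : OrthonormalBasis (Fin (m + 1)) ℝ (EuclideanSpace ℝ (Fin (m + 1))),
      ∀ i ∈ ({0} : Set (Fin (m + 1))), b i = ‖y‖⁻¹ • y := by
    refine Orthonormal.exists_orthonormalBasis_extension_of_card_eq (by simp)
      (v := fun _ ↦ ‖y‖⁻¹ • y) ⟨fun i ↦ ?_, fun i j hij ↦ (hij (Subsingleton.elim i j)).elim⟩
    simp [norm_smul, hy']
  have hinner (x : EuclideanSpace ℝ (Fin (m + 1))) : ⟪x, y⟫ = ‖y‖ * b.repr x 0 := by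
    rw [b.repr_apply_apply, hb 0 rfl, real_inner_smul_left, real_inner_comm,
      mul_inv_cancel_left₀ hy']
  let e := MeasurableEquiv.piFinSuccAbove (fun _ : Fin (m + 1) ↦ ℝ) 0
  let G : ℝ × (Fin m → ℝ) → ℝ≥0∞ :=
    fun q ↦ F (q.1 ^ 2 + ‖WithLp.toLp 2 q.2‖ ^ 2) (‖y‖ * q.1)
  have hG : Measurable G :=
    hF.comp (g := Function.uncurry F) (f := fun q : ℝ × (Fin m → ℝ) ↦
      (q.1 ^ 2 + ‖WithLp.toLp 2 q.2‖ ^ 2, ‖y‖ * q.1)) (by fun_prop)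
  have hmp : MeasurePreserving fun x : EuclideanSpace ℝ (Fin (m + 1)) ↦
      e (WithLp.ofLp (b.repr x)) :=
    (volume_preserving_piFinSuccAbove (fun _ ↦ ℝ) 0).comp
      ((PiLp.volume_preserving_ofLp _).comp b.measurePreserving_repr)
  calc
    _ = ∫⁻ x, G (e (WithLp.ofLp (b.repr x))) := by
      refine lintegral_congr fun x ↦ ?_
      rw [hinner, ← b.repr.norm_map x, EuclideanSpace.norm_sq_eq]
      simp [G, e, EuclideanSpace.norm_sq_eq, Fin.sum_univ_succ, Fin.tail]
    _ = ∫⁻ q, G q := hmp.lintegral_comp hG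
    _ = ∫⁻ u : ℝ, ∫⁻ z : Fin m → ℝ, G (u, z) := lintegral_prod _ hG.aemeasurable
    _ = _ := by
      refine lintegral_congr fun u ↦ ?_
      rw [← (PiLp.volume_preserving_ofLp _).lintegral_comp (f := fun z ↦ G (u, z))
        (hG.comp measurable_prodMk_left)]

/-- Reduction of the `n`-dimensional integral `∫ (1+|x|²+2γ⁻¹|⟨x,y⟩|)^{-(n/2+s)} dx`
to polar-type coordinates: it factors as
`σ_{n-2} · ∫₀^∞ t^{n-2}(1+t²)^{-(n/2+s)} dt · ∫_ℝ (1+u²+2γ⁻¹|y||u|)^{-(s+1/2)} du`,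
where `σ_{n-2} = 2π^{(n-1)/2}/Γ((n-1)/2)` is the surface measure of `S^{n-2} ⊂ ℝ^{n-1}`;
moreover the middle factor is finite. -/
theorem stmt5 (n : ℕ) (hn : 2 ≤ n) (s : ℝ) (hs : 0 < s)
    (y : EuclideanSpace ℝ (Fin n)) (hy0 : 0 < ‖y‖) (hy1 : ‖y‖ < 1) :
    (∫⁻ x : EuclideanSpace ℝ (Fin n),
        ENNReal.ofReal
          ((1 + ‖x‖ ^ 2 + 2 * (Real.sqrt (1 - ‖y‖ ^ 2))⁻¹ * |⟪x, y⟫|) ^ (-((n : ℝ) / 2 + s)))) =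
      ENNReal.ofReal (2 * Real.pi ^ (((n : ℝ) - 1) / 2) / Real.Gamma (((n : ℝ) - 1) / 2)) *
        (∫⁻ t in Set.Ioi (0 : ℝ),
          ENNReal.ofReal (t ^ ((n : ℝ) - 2) * (1 + t ^ 2) ^ (-((n : ℝ) / 2 + s)))) *
        (∫⁻ u : ℝ,
          ENNReal.ofReal
            ((1 + u ^ 2 + 2 * (Real.sqrt (1 - ‖y‖ ^ 2))⁻¹ * ‖y‖ * |u|) ^ (-(s + 1 / 2)))) ∧
      (∫⁻ t in Set.Ioi (0 : ℝ),
          ENNReal.ofReal (t ^ ((n : ℝ) - 2) * (1 + t ^ 2) ^ (-((n : ℝ) / 2 + s)))) ≠ ⊤ := by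
  obtain ⟨m, rfl⟩ : ∃ m, n = m + 1 := ⟨n - 1, by omega⟩
  have hm : 0 < m := by omega
  have : Nonempty (Fin m) := ⟨⟨0, hm⟩⟩
  set p : ℝ := ((m + 1 : ℕ) : ℝ) / 2 + s with hp
  set c : ℝ := (√(1 - ‖y‖ ^ 2))⁻¹
  have hc : 0 ≤ c := by positivity
  set I := ∫⁻ t in Set.Ioi (0 : ℝ),
    ENNReal.ofReal (t ^ (((m + 1 : ℕ) : ℝ) - 2) * (1 + t ^ 2) ^ (-p))
  have hcast : ((m + 1 : ℕ) : ℝ) - 1 = m := by push_cast; ring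
  rw [hcast, ← EuclideanSpace.toSphere_univ hm]
  have hpolar : ∫⁻ z : EuclideanSpace ℝ (Fin m), ENNReal.ofReal ((1 + ‖z‖ ^ 2) ^ (-p)) =
      (volume : Measure (EuclideanSpace ℝ (Fin m))).toSphere Set.univ * I := by
    rw [lintegral_fun_norm_addHaar volume
      (f := fun t ↦ ENNReal.ofReal ((1 + t ^ 2) ^ (-p))) (by fun_prop)]
    congr 1
    refine setLIntegral_congr_fun measurableSet_Ioi fun t (ht : 0 < t) ↦ ?_
    rw [← ENNReal.ofReal_mul (by positivity), finrank_euclideanSpace_fin, ← rpow_natCast,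
      Nat.cast_sub hm]
    congr 3
    push_cast
    ring
  constructor
  · rw [EuclideanSpace.lintegral_norm_sq_inner (norm_pos_iff.1 hy0)
      (F := fun a b ↦ ENNReal.ofReal ((1 + a + 2 * c * |b|) ^ (-p))) (by fun_prop), ← hpolar,
      ← lintegral_const_mul _ (by fun_prop)]
    refine lintegral_congr fun u ↦ ?_
    have hA : 0 < 1 + u ^ 2 + 2 * c * ‖y‖ * |u| := by positivity
    have hsplit (z : EuclideanSpace ℝ (Fin m)) :
        1 + (u ^ 2 + ‖z‖ ^ 2) + 2 * c * |‖y‖ * u| =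
          1 + u ^ 2 + 2 * c * ‖y‖ * |u| + ‖z‖ ^ 2 := by
      rw [abs_mul, abs_norm]
      ring
    simp_rw [hsplit]
    rw [lintegral_add_norm_sq_rpow_neg volume hA, finrank_euclideanSpace_fin]
    refine (mul_comm _ _).trans ?_
    congr 3
    rw [hp]
    push_cast
    ring
  · have hfin : ∫⁻ z : EuclideanSpace ℝ (Fin m), ENNReal.ofReal ((1 + ‖z‖ ^ 2) ^ (-p)) ≠ ⊤ := by
      have hint := integrable_rpow_neg_one_add_norm_sq (E := EuclideanSpace ℝ (Fin m))
        (μ := volume) (r := 2 * p) (by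
          rw [finrank_euclideanSpace_fin, hp]
          push_cast
          linarith)
      have hexp : -(2 * p) / 2 = -p := by ring
      rw [hexp] at hint
      exact hint.lintegral_lt_top.ne
    rw [hpolar] at hfin
    intro htop
    rw [htop, ENNReal.mul_top] at hfin
    · exact hfin rfl
    · rw [ne_eq, Measure.measure_univ_eq_zero]
      exact Measure.toSphere_ne_zero _
end

section
/- Let y₁ ∈ (1/√2, 1) and set γ := √(1−y₁²), so that 0 < γ < y₁. Then ∫_{-∞}^{∞} (1 + u² + 2γ^{-1} y₁ |u|)^{-1} du = γ (y₁² − γ²)^{-1/2} · log( (y₁ + √(y₁²−γ²)) / (y₁ − √(y₁²−γ²)) ). -/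
open MeasureTheory Real

/-- Partial-fraction evaluation of the integral over `(0, ∞)` of the reciprocal of a quadratic with
two distinct negative roots. -/
theorem integral_Ioi_inv_add_mul_add {p q : ℝ} (hp : 0 < p) (hpq : p < q) :
    ∫ u in Set.Ioi (0 : ℝ), ((u + p) * (u + q))⁻¹ = (q - p)⁻¹ * Real.log (q / p) := by
  have hq : 0 < q := hp.trans hpq
  have hd : 0 < q - p := sub_pos.2 hpq
  have hderiv : ∀ u ∈ Set.Ici (0 : ℝ), HasDerivAt
      (fun u ↦ (q - p)⁻¹ * Real.log ((u + p) / (u + q))) (((u + p) * (u + q))⁻¹) u := by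
    intro u hu
    have hu : 0 ≤ u := hu
    have hup : u + p ≠ 0 := by positivity
    have huq : u + q ≠ 0 := by positivity
    have h := ((((hasDerivAt_id u).add_const p).div ((hasDerivAt_id u).add_const q) huq).log
      (div_ne_zero hup huq)).const_mul (q - p)⁻¹
    refine h.congr_deriv ?_
    have := hd.ne'
    simp only [id, Pi.div_apply]
    field_simp
    ring
  have hlim : Filter.Tendsto (fun u : ℝ ↦ (u + p) / (u + q)) Filter.atTop (nhds 1) := by
    have h : Filter.Tendsto (fun u : ℝ ↦ 1 - (q - p) / (u + q)) Filter.atTop (nhds (1 - 0)) :=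
      tendsto_const_nhds.sub
        (tendsto_const_nhds.div_atTop (Filter.tendsto_atTop_add_const_right _ q Filter.tendsto_id))
    rw [sub_zero] at h
    refine h.congr' ?_
    filter_upwards [Filter.eventually_ge_atTop 0] with u hu
    have huq : u + q ≠ 0 := by positivity
    field_simp
    ring
  have hlim' := (hlim.log one_ne_zero).const_mul (q - p)⁻¹
  rw [integral_Ioi_of_hasDerivAt_of_nonneg' hderiv _ hlim']
  · rw [Real.log_one, zero_add, zero_add, ← inv_div q p, Real.log_inv]
    ring
  · intro u hu
    have hu : 0 < u := hu
    positivity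

/-- Explicit evaluation of `∫_ℝ (1+u²+2γ⁻¹y₁|u|)⁻¹ du` for `γ = √(1-y₁²)` and
`1/√2 < y₁ < 1` (so that `0 < γ < y₁`). -/
theorem stmt6 (y₁ γ : ℝ) (h1 : 1 / Real.sqrt 2 < y₁) (h2 : y₁ < 1)
    (hγ : γ = Real.sqrt (1 - y₁ ^ 2)) :
    (∫ u : ℝ, (1 + u ^ 2 + 2 * γ⁻¹ * y₁ * |u|)⁻¹) =
      γ * (Real.sqrt (y₁ ^ 2 - γ ^ 2))⁻¹ *
        Real.log ((y₁ + Real.sqrt (y₁ ^ 2 - γ ^ 2)) / (y₁ - Real.sqrt (y₁ ^ 2 - γ ^ 2))) := by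
  have hy : 0 < y₁ := lt_trans (by positivity) h1
  have hy2 : 1 / 2 < y₁ ^ 2 := by
    have h := pow_lt_pow_left₀ h1 (by positivity) two_ne_zero
    rwa [div_pow, one_pow, Real.sq_sqrt zero_le_two] at h
  have hγ0 : 0 < γ := hγ ▸ Real.sqrt_pos.2 (by nlinarith)
  have hγ2 : γ ^ 2 = 1 - y₁ ^ 2 := by rw [hγ, Real.sq_sqrt (by nlinarith)]
  have hs0 : 0 < Real.sqrt (y₁ ^ 2 - γ ^ 2) := Real.sqrt_pos.2 (by linarith)
  have hs2 : Real.sqrt (y₁ ^ 2 - γ ^ 2) ^ 2 = y₁ ^ 2 - γ ^ 2 := Real.sq_sqrt (by linarith)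
  generalize Real.sqrt (y₁ ^ 2 - γ ^ 2) = s at hs0 hs2 ⊢
  have hsy : 0 < y₁ - s := by nlinarith [sq_pos_of_pos hγ0]
  have hfactor : ∀ u : ℝ, 1 + u ^ 2 + 2 * γ⁻¹ * y₁ * u =
      (u + (y₁ - s) / γ) * (u + (y₁ + s) / γ) := by
    intro u
    field_simp
    linear_combination hs2
  have habs := integral_comp_abs (f := fun u : ℝ ↦ (1 + u ^ 2 + 2 * γ⁻¹ * y₁ * u)⁻¹)
  simp only [sq_abs] at habs
  rw [habs]
  simp only [hfactor]
  rw [integral_Ioi_inv_add_mul_add (div_pos hsy hγ0) (by gcongr; linarith),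
    div_div_div_cancel_right₀ hγ0.ne', ← sub_div, inv_div]
  have hdiff : y₁ + s - (y₁ - s) = 2 * s := by ring
  rw [hdiff]
  field_simp
end

section
/- Let n ≥ 1 be an integer and λ ∈ ℂ with Re λ > 0. Then for every y ∈ ℝⁿ with |y| < 1 the function x ↦ (1 + (x+iy)²)^{-(λ+n/2)} is absolutely integrable on ℝⁿ and ∫_{ℝⁿ} (1 + (x+iy)²)^{-(λ+n/2)} dx = ∫_{ℝⁿ} (1 + |x|²)^{-(λ+n/2)} dx; in particular this integral is independent of y. -/
open MeasureTheory Real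

lemma re_one_add_sum_sq {n : ℕ} (y x : EuclideanSpace ℝ (Fin n)) (ζ : ℂ) :
    (1 + ∑ j, ((x j : ℂ) + ζ * (y j : ℂ)) ^ 2).re =
      1 + ‖x + ζ.re • y‖ ^ 2 - (|ζ.im| * ‖y‖) ^ 2 := by
  rw [mul_pow, sq_abs, EuclideanSpace.real_norm_sq_eq, EuclideanSpace.real_norm_sq_eq,
    Finset.mul_sum, add_sub_assoc, ← Finset.sum_sub_distrib]
  simp only [Complex.add_re, Complex.one_re, Complex.re_sum]
  congr 1
  refine Finset.sum_congr rfl fun j _ => ?_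
  simp [pow_two]
  ring

lemma one_add_norm_sq_le_mul_re {n : ℕ} (y : EuclideanSpace ℝ (Fin n)) {r R : ℝ}
    (hr : r < 1) :
    ∃ K : ℝ, 0 < K ∧ ∀ ζ : ℂ, |ζ.im| * ‖y‖ < r → |ζ.re| < R →
      ∀ x : EuclideanSpace ℝ (Fin n),
        1 + ‖x‖ ^ 2 ≤ K * (1 + ∑ j, ((x j : ℂ) + ζ * (y j : ℂ)) ^ 2).re := by
  by_cases hr0 : 0 < r
  swap
  · refine ⟨1, one_pos, fun ζ hζ => ?_⟩
    have : 0 ≤ |ζ.im| * ‖y‖ := by positivity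
    linarith
  have hε : 0 < 1 - r ^ 2 := by nlinarith
  refine ⟨(1 + 2 * (R * ‖y‖) ^ 2) / (1 - r ^ 2) + 2, by positivity, fun ζ him hre x => ?_⟩
  rw [re_one_add_sum_sq]
  set A := 1 + 2 * (R * ‖y‖) ^ 2 with hA
  have h1 : ‖x‖ ≤ ‖x + ζ.re • y‖ + R * ‖y‖ := by
    calc ‖x‖ = ‖(x + ζ.re • y) - ζ.re • y‖ := by simp
      _ ≤ ‖x + ζ.re • y‖ + ‖ζ.re • y‖ := norm_sub_le _ _
      _ ≤ _ := by rw [norm_smul, Real.norm_eq_abs]; gcongr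
  have h2 : ‖x‖ ^ 2 ≤ 2 * ‖x + ζ.re • y‖ ^ 2 + 2 * (R * ‖y‖) ^ 2 := by
    have := pow_le_pow_left₀ (norm_nonneg x) h1 2
    nlinarith [sq_nonneg (‖x + ζ.re • y‖ - R * ‖y‖)]
  have h3 : (|ζ.im| * ‖y‖) ^ 2 ≤ r ^ 2 := by gcongr
  have hA0 : 0 < A := by positivity
  have hq : 0 < A / (1 - r ^ 2) := by positivity
  calc 1 + ‖x‖ ^ 2 ≤ A + 2 * ‖x + ζ.re • y‖ ^ 2 := by rw [hA]; linarith
    _ ≤ (A / (1 - r ^ 2) + 2) * ((1 - r ^ 2) + ‖x + ζ.re • y‖ ^ 2) := by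
      have : A / (1 - r ^ 2) * (1 - r ^ 2) = A := by field_simp
      nlinarith [mul_nonneg hq.le (sq_nonneg ‖x + ζ.re • y‖)]
    _ ≤ _ := by
      apply mul_le_mul_of_nonneg_left _ (by positivity)
      linarith

lemma norm_cpow_neg_le {w μ : ℂ} {K t : ℝ} (hK : 0 < K) (ht : 0 < t) (hw : t ≤ K * w.re)
    (hμ : 0 ≤ μ.re) :
    ‖w ^ (-μ)‖ ≤ K ^ μ.re * Real.exp (π * |μ.im|) * t ^ (-μ.re) := by
  have htw : t / K ≤ ‖w‖ := by
    rw [div_le_iff₀' hK]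
    exact hw.trans (mul_le_mul_of_nonneg_left (Complex.re_le_norm w) hK.le)
  have h1 : ‖w‖ ^ (-μ.re) ≤ K ^ μ.re * t ^ (-μ.re) := by
    calc ‖w‖ ^ (-μ.re) ≤ (t / K) ^ (-μ.re) :=
          Real.rpow_le_rpow_of_nonpos (by positivity) htw (by linarith)
      _ = K ^ μ.re * t ^ (-μ.re) := by
          rw [Real.div_rpow ht.le hK.le, Real.rpow_neg hK.le, div_inv_eq_mul, mul_comm]
  have h2 : Real.exp (w.arg * μ.im) ≤ Real.exp (π * |μ.im|) := by
    apply Real.exp_le_exp.2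
    calc w.arg * μ.im ≤ |w.arg| * |μ.im| := by rw [← abs_mul]; exact le_abs_self _
      _ ≤ _ := by gcongr; exact Complex.abs_arg_le_pi w
  calc ‖w ^ (-μ)‖ ≤ ‖w‖ ^ (-μ).re / Real.exp (w.arg * (-μ).im) := Complex.norm_cpow_le w (-μ)
    _ = ‖w‖ ^ (-μ.re) * Real.exp (w.arg * μ.im) := by
      rw [Complex.neg_re, Complex.neg_im, mul_neg, Real.exp_neg, div_inv_eq_mul]
    _ ≤ (K ^ μ.re * t ^ (-μ.re)) * Real.exp (π * |μ.im|) := by gcongr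
    _ = _ := by ring

lemma hasDerivAt_one_add_sum_sq {n : ℕ} (y x : EuclideanSpace ℝ (Fin n)) (ζ : ℂ) :
    HasDerivAt (fun ζ : ℂ => 1 + ∑ j, ((x j : ℂ) + ζ * (y j : ℂ)) ^ 2)
      (∑ j, 2 * ((x j : ℂ) + ζ * (y j : ℂ)) * (y j : ℂ)) ζ := by
  refine HasDerivAt.const_add _ (HasDerivAt.fun_sum fun j _ => ?_)
  simpa using (((hasDerivAt_id ζ).mul_const (y j : ℂ)).const_add (x j : ℂ)).fun_pow 2

lemma norm_deriv_one_add_sum_sq_le {n : ℕ} (y x : EuclideanSpace ℝ (Fin n)) (ζ : ℂ) :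
    ‖∑ j, 2 * ((x j : ℂ) + ζ * (y j : ℂ)) * (y j : ℂ)‖ ≤
      n * (2 * (1 + ‖ζ‖ * ‖y‖) * ‖y‖) * (1 + ‖x‖ ^ 2) := by
  have h : ∀ j ∈ Finset.univ, ‖2 * ((x j : ℂ) + ζ * (y j : ℂ)) * (y j : ℂ)‖ ≤
      2 * (1 + ‖ζ‖ * ‖y‖) * ‖y‖ * (1 + ‖x‖ ^ 2) := fun j _ => by
    have hx : ‖(x j : ℂ)‖ ≤ ‖x‖ := by
      rw [Complex.norm_real]; exact PiLp.norm_apply_le x j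
    have hy : ‖(y j : ℂ)‖ ≤ ‖y‖ := by
      rw [Complex.norm_real]; exact PiLp.norm_apply_le y j
    have h1 : ‖(x j : ℂ) + ζ * (y j : ℂ)‖ ≤ (1 + ‖ζ‖ * ‖y‖) * (1 + ‖x‖ ^ 2) := by
      calc _ ≤ ‖(x j : ℂ)‖ + ‖ζ‖ * ‖(y j : ℂ)‖ := by
            rw [← norm_mul]; exact norm_add_le _ _
        _ ≤ ‖x‖ + ‖ζ‖ * ‖y‖ := by gcongr
        _ ≤ _ := by
          have : 0 ≤ ‖ζ‖ * ‖y‖ := by positivity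
          nlinarith [sq_nonneg (‖x‖ - 1), mul_nonneg this (sq_nonneg ‖x‖)]
    rw [norm_mul, norm_mul, Complex.norm_ofNat]
    calc _ ≤ 2 * ((1 + ‖ζ‖ * ‖y‖) * (1 + ‖x‖ ^ 2)) * ‖y‖ := by gcongr
      _ = _ := by ring
  refine (norm_sum_le_of_le _ h).trans_eq ?_
  simp
  ring

lemma re_one_add_sum_sq_pos {n : ℕ} {y : EuclideanSpace ℝ (Fin n)} {ζ : ℂ}
    (hζ : |ζ.im| * ‖y‖ < 1) (x : EuclideanSpace ℝ (Fin n)) :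
    0 < (1 + ∑ j, ((x j : ℂ) + ζ * (y j : ℂ)) ^ 2).re := by
  rw [re_one_add_sum_sq]
  have h0 : 0 ≤ |ζ.im| * ‖y‖ := by positivity
  nlinarith [sq_nonneg ‖x + ζ.re • y‖]

lemma continuous_one_add_sum_sq_cpow {n : ℕ} {y : EuclideanSpace ℝ (Fin n)} {ζ : ℂ}
    (hζ : |ζ.im| * ‖y‖ < 1) (μ : ℂ) :
    Continuous fun x : EuclideanSpace ℝ (Fin n) =>
      (1 + ∑ j, ((x j : ℂ) + ζ * (y j : ℂ)) ^ 2) ^ μ :=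
  Continuous.cpow (by fun_prop) continuous_const
    fun x => Or.inl (re_one_add_sum_sq_pos hζ x)

lemma integrable_one_add_norm_sq_rpow {n : ℕ} {s : ℝ} (hs : (n : ℝ) < 2 * s) :
    Integrable fun x : EuclideanSpace ℝ (Fin n) => (1 + ‖x‖ ^ 2) ^ (-s) := by
  have := integrable_rpow_neg_one_add_norm_sq (E := EuclideanSpace ℝ (Fin n))
    (μ := volume) (r := 2 * s) (by simpa using hs)
  simpa [neg_div] using this

/-- The integral of the complex-shifted kernel is a holomorphic function of the shift, with
absolutely convergent integral. -/
lemma integrable_and_exists_hasDerivAt {n : ℕ} {μ : ℂ} (hμ : (n : ℝ) < 2 * μ.re)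
    {y : EuclideanSpace ℝ (Fin n)} {ζ : ℂ} (hζ : |ζ.im| * ‖y‖ < 1) :
    Integrable (fun x : EuclideanSpace ℝ (Fin n) =>
        (1 + ∑ j, ((x j : ℂ) + ζ * (y j : ℂ)) ^ 2) ^ (-μ)) ∧
      ∃ d : ℂ, HasDerivAt (fun ζ : ℂ => ∫ x : EuclideanSpace ℝ (Fin n),
        (1 + ∑ j, ((x j : ℂ) + ζ * (y j : ℂ)) ^ 2) ^ (-μ)) d ζ := by
  have hμ0 : 0 ≤ μ.re := by
    have : (0 : ℝ) ≤ n := n.cast_nonneg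
    linarith
  obtain ⟨r, hζr, hr⟩ := exists_between hζ
  obtain ⟨K, hK, hbound⟩ := one_add_norm_sq_le_mul_re y (R := ‖ζ‖ + 1) hr
  have hint := integrable_one_add_norm_sq_rpow hμ
  have hζ1 : |ζ.re| < ‖ζ‖ + 1 := by linarith [Complex.abs_re_le_norm ζ]
  have hI : Integrable (fun x : EuclideanSpace ℝ (Fin n) =>
      (1 + ∑ j, ((x j : ℂ) + ζ * (y j : ℂ)) ^ 2) ^ (-μ)) :=
    (hint.const_mul (K ^ μ.re * Real.exp (π * |μ.im|))).mono'
      (continuous_one_add_sum_sq_cpow hζ _).aestronglyMeasurable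
      (.of_forall fun x => norm_cpow_neg_le hK (by positivity) (hbound ζ hζr hζ1 x) hμ0)
  refine ⟨hI, ?_⟩
  let V : Set ℂ := {z | |z.im| * ‖y‖ < r} ∩ Metric.ball 0 (‖ζ‖ + 1)
  have hV : V ∈ nhds ζ := by
    refine (IsOpen.inter ?_ Metric.isOpen_ball).mem_nhds ⟨hζr, by simp⟩
    exact isOpen_lt (by fun_prop) continuous_const
  have hV1 : ∀ z ∈ V, |z.im| * ‖y‖ < 1 := fun z hz => lt_trans hz.1 hr
  have hVn : ∀ z ∈ V, ‖z‖ < ‖ζ‖ + 1 := fun z hz => by simpa using hz.2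
  refine ⟨_, (hasDerivAt_integral_of_dominated_loc_of_deriv_le (μ := volume) (s := V)
    (F := fun (z : ℂ) (x : EuclideanSpace ℝ (Fin n)) =>
      (1 + ∑ j, ((x j : ℂ) + z * (y j : ℂ)) ^ 2) ^ (-μ))
    (F' := fun (z : ℂ) (x : EuclideanSpace ℝ (Fin n)) =>
      -μ * (1 + ∑ j, ((x j : ℂ) + z * (y j : ℂ)) ^ 2) ^ (-μ - 1) *
        ∑ j, 2 * ((x j : ℂ) + z * (y j : ℂ)) * (y j : ℂ))
    (bound := fun x => ‖μ‖ * (K ^ (μ + 1).re * Real.exp (π * |(μ + 1).im|)) *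
      (n * (2 * (1 + (‖ζ‖ + 1) * ‖y‖) * ‖y‖)) * (1 + ‖x‖ ^ 2) ^ (-μ.re))
    hV ?_ hI ?_ ?_ (hint.const_mul _) ?_).2⟩
  · filter_upwards [hV] with z hz
    exact (continuous_one_add_sum_sq_cpow (hV1 z hz) _).aestronglyMeasurable
  · exact ((continuous_const.mul (continuous_one_add_sum_sq_cpow hζ _)).mul
      (by fun_prop)).aestronglyMeasurable
  · refine .of_forall fun x z hz => ?_
    have hz1 : |z.re| < ‖ζ‖ + 1 := (Complex.abs_re_le_norm z).trans_lt (hVn z hz)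
    have hx : (0 : ℝ) < 1 + ‖x‖ ^ 2 := by positivity
    have h1 := norm_cpow_neg_le (μ := μ + 1) hK hx (hbound z hz.1 hz1 x)
      (by rw [Complex.add_re, Complex.one_re]; linarith)
    have h2 : ‖∑ j, 2 * ((x j : ℂ) + z * (y j : ℂ)) * (y j : ℂ)‖ ≤
        n * (2 * (1 + (‖ζ‖ + 1) * ‖y‖) * ‖y‖) * (1 + ‖x‖ ^ 2) := by
      refine (norm_deriv_one_add_sum_sq_le y x z).trans ?_
      have := (hVn z hz).le
      gcongr
    have h3 : (1 + ‖x‖ ^ 2) ^ (-(μ + 1).re) * (1 + ‖x‖ ^ 2) = (1 + ‖x‖ ^ 2) ^ (-μ.re) := by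
      rw [← Real.rpow_add_one hx.ne']
      simp
    rw [norm_mul, norm_mul, norm_neg, ← h3, ← neg_add']
    calc _ ≤ ‖μ‖ * (K ^ (μ + 1).re * Real.exp (π * |(μ + 1).im|) *
          (1 + ‖x‖ ^ 2) ^ (-(μ + 1).re)) *
          (n * (2 * (1 + (‖ζ‖ + 1) * ‖y‖) * ‖y‖) * (1 + ‖x‖ ^ 2)) := by gcongr
      _ = _ := by ring
  · refine .of_forall fun x z hz => ?_
    exact (hasDerivAt_one_add_sum_sq y x z).cpow_const
      (Or.inl (re_one_add_sum_sq_pos (hV1 z hz) x))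

lemma integral_add_ofReal {n : ℕ} (μ : ℂ) (y : EuclideanSpace ℝ (Fin n)) (ζ : ℂ) (s : ℝ) :
    ∫ x : EuclideanSpace ℝ (Fin n), (1 + ∑ j, ((x j : ℂ) + (ζ + s) * (y j : ℂ)) ^ 2) ^ μ =
      ∫ x : EuclideanSpace ℝ (Fin n), (1 + ∑ j, ((x j : ℂ) + ζ * (y j : ℂ)) ^ 2) ^ μ := by
  rw [← integral_add_right_eq_self (fun x : EuclideanSpace ℝ (Fin n) =>
    (1 + ∑ j, ((x j : ℂ) + ζ * (y j : ℂ)) ^ 2) ^ μ) (s • y)]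
  congr! 6 with x j
  simp
  ring

/-- For `Re λ > 0` and `|y| < 1`, the kernel `x ↦ (1+(x+iy)²)^{-(λ+n/2)}` is absolutely
integrable on `ℝⁿ` and its integral is independent of `y` (Cauchy's theorem):
it equals `∫ (1+|x|²)^{-(λ+n/2)} dx`. -/
theorem stmt8 (n : ℕ) (hn : 1 ≤ n) (lam : ℂ) (hlam : 0 < lam.re)
    (y : EuclideanSpace ℝ (Fin n)) (hy : ‖y‖ < 1) :
    Integrable (fun x : EuclideanSpace ℝ (Fin n) =>
        (1 + ∑ j, ((x j : ℂ) + Complex.I * (y j : ℂ)) ^ 2) ^ (-(lam + (n : ℂ) / 2))) ∧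
      (∫ x : EuclideanSpace ℝ (Fin n),
          (1 + ∑ j, ((x j : ℂ) + Complex.I * (y j : ℂ)) ^ 2) ^ (-(lam + (n : ℂ) / 2))) =
        ∫ x : EuclideanSpace ℝ (Fin n),
          ((1 : ℂ) + (‖x‖ : ℂ) ^ 2) ^ (-(lam + (n : ℂ) / 2)) := by
  have hμ : (n : ℝ) < 2 * (lam + (n : ℂ) / 2).re := by
    have : ((n : ℂ) / 2).re = n / 2 := by simp
    rw [Complex.add_re, this]
    linarith
  generalize lam + (n : ℂ) / 2 = μ at hμ
  let U : Set ℂ := {z | |z.im| * ‖y‖ < 1}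
  have hUo : IsOpen U := isOpen_lt (by fun_prop) continuous_const
  have hUc : Convex ℝ U := by
    intro a ha b hb p q hp hq hpq
    have h : |(p • a + q • b).im| ≤ p * |a.im| + q * |b.im| := by
      simpa [abs_mul, abs_of_nonneg hp, abs_of_nonneg hq] using
        abs_add_le (p * a.im) (q * b.im)
    have hle := mul_le_mul_of_nonneg_right h (norm_nonneg y)
    have hlt := convex_Iio (1 : ℝ) ha hb hp hq hpq
    simp only [smul_eq_mul, Set.mem_Iio] at hlt
    change |(p • a + q • b).im| * ‖y‖ < 1
    linarith
  have hI : Complex.I ∈ U := by simpa [U] using hy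
  have h0 : (0 : ℂ) ∈ U := by simp [U]
  refine ⟨(integrable_and_exists_hasDerivAt hμ hI).1, ?_⟩
  let G : ℂ → ℂ := fun z => ∫ x : EuclideanSpace ℝ (Fin n),
    (1 + ∑ j, ((x j : ℂ) + z * (y j : ℂ)) ^ 2) ^ (-μ)
  have hG : ∀ z ∈ U, HasDerivAt G 0 z := by
    intro z hz
    obtain ⟨d, hd⟩ := (integrable_and_exists_hasDerivAt hμ hz).2
    have h1 : HasDerivAt (fun s : ℝ => G (z + s)) d 0 := by
      have h2 : HasDerivAt G d (z + ((0 : ℝ) : ℂ)) := by simpa using hd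
      exact (h2.comp_const_add z _).comp_ofReal
    have h2 : (fun s : ℝ => G (z + s)) = fun _ => G z :=
      funext fun s => integral_add_ofReal _ y z s
    rw [h2] at h1
    rwa [h1.unique (hasDerivAt_const _ _)] at hd
  have hconst : G Complex.I = G 0 :=
    hUo.is_const_of_deriv_eq_zero hUc.isPreconnected
      (fun z hz => (hG z hz).differentiableAt.differentiableWithinAt)
      (fun z hz => (hG z hz).deriv) hI h0
  refine hconst.trans ?_
  simp only [G]
  congr! 3 with x
  rw [← Complex.ofReal_pow, EuclideanSpace.real_norm_sq_eq]
  simp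
end

section
/- Let n ≥ 1 be an integer and λ ∈ ℂ. Define p : ℝⁿ × (0,∞) → ℂ by p(x,t) := t^{λ+n/2} (t² + |x|²)^{-(λ+n/2)}. Then p satisfies the eigenvalue equation for the hyperbolic Laplace–Beltrami operator: for all (x,t) ∈ ℝⁿ × (0,∞), t²( ∂²p/∂t² + ∑_{j=1}^n ∂²p/∂x_j² ) − (n−1) t ∂p/∂t = (λ² − n²/4) p(x,t). -/
open MeasureTheory Real

theorem hasDerivAt_ofReal_comp_cpow {f : ℝ → ℝ} {f' s : ℝ} (c : ℂ) (hf : HasDerivAt f f' s)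
    (hs : 0 < f s) :
    HasDerivAt (fun τ => (f τ : ℂ) ^ c) ((f s : ℂ) ^ c * (c * f' / f s)) s := by
  have hne : (f s : ℂ) ≠ 0 := by exact_mod_cast hs.ne'
  have hp : HasDerivAt (fun z : ℂ => z ^ c) (c * (f s : ℂ) ^ (c - 1) * 1) (f s : ℂ) :=
    (hasDerivAt_id (f s : ℂ)).cpow_const (Or.inl (by simpa using hs))
  refine (HasDerivAt.scomp s hp hf.ofReal_comp).congr_deriv ?_
  rw [Complex.cpow_sub _ _ hne, Complex.cpow_one, smul_eq_mul]
  field_simp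

theorem iteratedDeriv_two_of_logDeriv {g h : ℝ → ℂ} {h' : ℂ} {s : ℝ}
    (hg : ∀ᶠ τ in nhds s, HasDerivAt g (g τ * h τ) τ) (hh : HasDerivAt h h' s) :
    iteratedDeriv 2 g s = g s * (h s ^ 2 + h') := by
  have hd : deriv g =ᶠ[nhds s] fun τ => g τ * h τ := hg.mono fun τ hτ => hτ.deriv
  rw [iteratedDeriv_succ, iteratedDeriv_one, hd.deriv_eq, (hg.self_of_nhds.fun_mul hh).deriv]
  ring

theorem hasDerivAt_poissonKernel_height {S t : ℝ} (hS : 0 ≤ S) (ht : 0 < t) (a : ℂ) :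
    HasDerivAt (fun τ : ℝ => (τ : ℂ) ^ a * ((↑(τ ^ 2 + S) : ℂ) ^ (-a)))
      ((t : ℂ) ^ a * ((↑(t ^ 2 + S) : ℂ) ^ (-a)) * (a / t - 2 * a * t / ↑(t ^ 2 + S))) t := by
  have h1 := hasDerivAt_ofReal_comp_cpow a (hasDerivAt_id t) ht
  have h2 := hasDerivAt_ofReal_comp_cpow (-a) ((hasDerivAt_pow 2 t).add_const S)
    (by positivity)
  refine (h1.fun_mul h2).congr_deriv ?_
  simp only [id]
  push_cast
  ring

theorem iteratedDeriv_two_poissonKernel_height {S t : ℝ} (hS : 0 ≤ S) (ht : 0 < t) (a : ℂ) :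
    iteratedDeriv 2 (fun τ : ℝ => (τ : ℂ) ^ a * ((↑(τ ^ 2 + S) : ℂ) ^ (-a))) t =
      (t : ℂ) ^ a * ((↑(t ^ 2 + S) : ℂ) ^ (-a)) *
        ((a / t - 2 * a * t / ↑(t ^ 2 + S)) ^ 2 +
          (-a / t ^ 2 - 2 * a / ↑(t ^ 2 + S) + 4 * a * t ^ 2 / (↑(t ^ 2 + S)) ^ 2)) := by
  have hne : (t : ℂ) ≠ 0 := by exact_mod_cast ht.ne'
  have hW : ((t ^ 2 + S : ℝ) : ℂ) ≠ 0 := by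
    have : t ^ 2 + S ≠ 0 := by positivity
    exact_mod_cast this
  have hid : HasDerivAt (fun τ : ℝ => (τ : ℂ)) 1 t := (hasDerivAt_id t).ofReal_comp
  have hq : HasDerivAt (fun τ : ℝ => ((τ ^ 2 + S : ℝ) : ℂ)) (2 * t) t := by
    simpa using ((hasDerivAt_pow 2 t).add_const S).ofReal_comp
  have hh := ((hasDerivAt_const t a).fun_div hid hne).fun_sub
    ((hid.const_mul (2 * a)).fun_div hq hW)
  rw [iteratedDeriv_two_of_logDeriv
    ((lt_mem_nhds ht).mono fun τ hτ => hasDerivAt_poissonKernel_height hS hτ a) hh]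
  generalize ((t ^ 2 + S : ℝ) : ℂ) = W at hW ⊢
  field_simp
  ring

theorem iteratedDeriv_two_poissonKernel_horizontal {C : ℝ} (hC : 0 < C) (k a : ℂ) (s : ℝ) :
    iteratedDeriv 2 (fun r : ℝ => k * ((↑(C + r ^ 2) : ℂ) ^ (-a))) s =
      k * ((↑(C + s ^ 2) : ℂ) ^ (-a)) *
        (4 * a * (a + 1) * s ^ 2 / (↑(C + s ^ 2)) ^ 2 - 2 * a / ↑(C + s ^ 2)) := by
  have hW : ((C + s ^ 2 : ℝ) : ℂ) ≠ 0 := by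
    have : C + s ^ 2 ≠ 0 := by positivity
    exact_mod_cast this
  have hg (r : ℝ) : HasDerivAt (fun r : ℝ => k * ((↑(C + r ^ 2) : ℂ) ^ (-a)))
      (k * ((↑(C + r ^ 2) : ℂ) ^ (-a)) * (-2 * a * r / ↑(C + r ^ 2))) r := by
    refine ((hasDerivAt_ofReal_comp_cpow (-a) ((hasDerivAt_pow 2 r).const_add C)
      (by positivity)).const_mul k).congr_deriv ?_
    push_cast
    ring
  have hid : HasDerivAt (fun τ : ℝ => (τ : ℂ)) 1 s := (hasDerivAt_id s).ofReal_comp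
  have hq : HasDerivAt (fun r : ℝ => ((C + r ^ 2 : ℝ) : ℂ)) (2 * s) s := by
    simpa using ((hasDerivAt_pow 2 s).const_add C).ofReal_comp
  have hh := (hid.const_mul (-2 * a)).fun_div hq hW
  rw [iteratedDeriv_two_of_logDeriv (Filter.Eventually.of_forall hg) hh]
  generalize ((C + s ^ 2 : ℝ) : ℂ) = W at hW ⊢
  field_simp
  ring

/-- The Poisson kernel `p(x,t) = t^{λ+n/2}(t²+|x|²)^{-(λ+n/2)}` on the upper half-space
`ℝⁿ × (0,∞)` is an eigenfunction of the hyperbolic Laplace–Beltrami operator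
`t²(∂_t² + Δ_x) - (n-1) t ∂_t` with eigenvalue `λ² - n²/4`. -/
theorem stmt10 (n : ℕ) (hn : 1 ≤ n) (lam : ℂ) :
    ∀ (x : Fin n → ℝ) (t : ℝ), 0 < t →
      (let p : (Fin n → ℝ) → ℝ → ℂ := fun x t =>
        (t : ℂ) ^ (lam + (n : ℂ) / 2) *
          ((↑(t ^ 2 + ∑ j, x j ^ 2) : ℂ) ^ (-(lam + (n : ℂ) / 2)))
      (t : ℂ) ^ 2 *
          (iteratedDeriv 2 (fun τ => p x τ) t +
            ∑ j, iteratedDeriv 2 (fun r => p (Function.update x j r) t) (x j)) -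
        ((n : ℂ) - 1) * (t : ℂ) * deriv (fun τ => p x τ) t =
        (lam ^ 2 - (n : ℂ) ^ 2 / 4) * p x t) := by
  intro x t ht p
  have hS : 0 ≤ ∑ j, x j ^ 2 := Finset.sum_nonneg fun j _ => sq_nonneg (x j)
  have hx (j : Fin n) : iteratedDeriv 2 (fun r => p (Function.update x j r) t) (x j) =
      p x t * (4 * (lam + n / 2) * (lam + n / 2 + 1) * (x j : ℂ) ^ 2 /
        (↑(t ^ 2 + ∑ j, x j ^ 2)) ^ 2 - 2 * (lam + n / 2) / ↑(t ^ 2 + ∑ j, x j ^ 2)) := by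
    have hsum (r : ℝ) : t ^ 2 + ∑ i, Function.update x j r i ^ 2 =
        (t ^ 2 + ∑ i ∈ Finset.univ.erase j, x i ^ 2) + r ^ 2 := by
      rw [← Finset.sum_erase_add _ _ (Finset.mem_univ j), Function.update_self, add_assoc]
      congr 2
      exact Finset.sum_congr rfl fun i hi => by
        rw [Function.update_of_ne (Finset.ne_of_mem_erase hi)]
    have hW : (t ^ 2 + ∑ i ∈ Finset.univ.erase j, x i ^ 2) + x j ^ 2 = t ^ 2 + ∑ i, x i ^ 2 := by
      rw [← hsum, Function.update_eq_self]
    have hC : 0 < t ^ 2 + ∑ i ∈ Finset.univ.erase j, x i ^ 2 :=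
      add_pos_of_pos_of_nonneg (by positivity) (Finset.sum_nonneg fun i _ => sq_nonneg (x i))
    simp only [p, hsum]
    rw [iteratedDeriv_two_poissonKernel_horizontal hC, hW]
  rw [Finset.sum_congr rfl fun j _ => hx j, ← Finset.mul_sum, Finset.sum_sub_distrib,
    ← Finset.sum_div, ← Finset.mul_sum, Finset.sum_const, Finset.card_univ, Fintype.card_fin,
    nsmul_eq_mul]
  simp only [p]
  rw [iteratedDeriv_two_poissonKernel_height hS ht, (hasDerivAt_poissonKernel_height hS ht _).deriv]
  have hne : (t : ℂ) ≠ 0 := by exact_mod_cast ht.ne'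
  have hsq : ∑ j, (x j : ℂ) ^ 2 = ((t ^ 2 + ∑ j, x j ^ 2 : ℝ) : ℂ) - (t : ℂ) ^ 2 := by
    push_cast
    ring
  have hW : ((t ^ 2 + ∑ j, x j ^ 2 : ℝ) : ℂ) ≠ 0 := by
    have : t ^ 2 + ∑ j, x j ^ 2 ≠ 0 := by positivity
    exact_mod_cast this
  rw [hsq]
  generalize ((t ^ 2 + ∑ j, x j ^ 2 : ℝ) : ℂ) = W at hW ⊢
  generalize (t : ℂ) ^ (lam + (n : ℂ) / 2) * W ^ (-(lam + (n : ℂ) / 2)) = P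
  field_simp
  ring
end

section
/- Let n ≥ 1 be an integer and α > 0. Then for every ξ ∈ ℝⁿ, (1/Γ(α)) ∫_{{y ∈ ℝⁿ : |y| < 1}} e^{-2⟨y,ξ⟩} (1 − |y|²)^{α−1} dy = π^{n/2} ∑_{m=0}^{∞} |ξ|^{2m} / ( m! · Γ(m + α + n/2) ). -/
open MeasureTheory Real
open scoped RealInnerProductSpace

open Module ProbabilityTheory Set Metric

section Moments

variable {E : Type*} [NormedAddCommGroup E] [InnerProductSpace ℝ E] [FiniteDimensional ℝ E]
  [MeasurableSpace E] [BorelSpace E]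

/-- Integration in polar coordinates of a power of a linear form times a radial function. -/
theorem integral_inner_pow_mul_fun_norm [Nontrivial E] (ξ : E) (k : ℕ) (g : ℝ → ℝ) :
    ∫ y : E, ⟪y, ξ⟫ ^ k * g ‖y‖ =
      (∫ ω : sphere (0 : E) 1, ⟪(ω : E), ξ⟫ ^ k ∂(volume : Measure E).toSphere) *
        ∫ r in Ioi (0 : ℝ), r ^ (finrank ℝ E - 1 + k) * g r := by
  set μ : Measure E := volume
  calc
    ∫ y, ⟪y, ξ⟫ ^ k * g ‖y‖ ∂μ
      = ∫ y : ({(0)}ᶜ : Set E), ⟪y.1, ξ⟫ ^ k * g ‖y.1‖ ∂(μ.comap (↑)) := by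
      rw [integral_subtype_comap (measurableSet_singleton _).compl
        fun y ↦ ⟪y, ξ⟫ ^ k * g ‖y‖, restrict_compl_singleton]
    _ = ∫ x : sphere (0 : E) 1 × Ioi (0 : ℝ),
          ⟪(x.1 : E), ξ⟫ ^ k * ((x.2 : ℝ) ^ k * g x.2)
          ∂μ.toSphere.prod (.volumeIoiPow (finrank ℝ E - 1)) := by
      rw [← μ.measurePreserving_homeomorphUnitSphereProd.integral_comp
        (Homeomorph.measurableEmbedding _)]
      refine integral_congr_ae (.of_forall fun y ↦ ?_)
      have hy : ‖(y : E)‖ ≠ 0 := norm_ne_zero_iff.2 y.2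
      simp only [homeomorphUnitSphereProd_apply_fst_coe, homeomorphUnitSphereProd_apply_snd_coe,
        inner_smul_left, ← mul_assoc, ← mul_pow]
      simp [mul_right_comm _ _ ‖(y : E)‖, hy]
    _ = (∫ ω : sphere (0 : E) 1, ⟪(ω : E), ξ⟫ ^ k ∂μ.toSphere) *
          ∫ r : Ioi (0 : ℝ), (r : ℝ) ^ k * g r ∂.volumeIoiPow (finrank ℝ E - 1) :=
      integral_prod_mul (fun ω : sphere (0 : E) 1 ↦ ⟪(ω : E), ξ⟫ ^ k)
        fun r : Ioi (0 : ℝ) ↦ (r : ℝ) ^ k * g r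
    _ = _ := by
      congr 1
      simp only [Measure.volumeIoiPow, ENNReal.ofReal]
      rw [integral_withDensity_eq_integral_smul, integral_subtype_comap measurableSet_Ioi
          fun a ↦ Real.toNNReal (a ^ (finrank ℝ E - 1)) • (a ^ k * g a),
        setIntegral_congr_fun measurableSet_Ioi fun x hx ↦ ?_]
      · rw [NNReal.smul_def, Real.coe_toNNReal _ (pow_nonneg hx.out.le _), smul_eq_mul, pow_add,
          mul_assoc]
      · exact (measurable_subtype_coe.pow_const _).real_toNNReal

/-- The Laplace transform of the Gaussian weight `exp (-‖v‖ ^ 2)`. -/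
theorem integral_exp_mul_inner_mul_exp_neg_norm_sq (w : E) (c : ℝ) :
    ∫ v : E, exp (c * ⟪v, w⟫) * exp (-‖v‖ ^ 2) =
      π ^ ((finrank ℝ E : ℝ) / 2) * exp (c ^ 2 * ‖w‖ ^ 2 / 4) := by
  have h := GaussianFourier.integral_cexp_neg_mul_sq_norm_add (b := 1) (by simp) (c : ℂ) w
  rw [← Complex.ofReal_inj, ← integral_complex_ofReal]
  push_cast
  rw [Complex.ofReal_cpow pi_pos.le]
  convert! h using 2
  · ext v
    rw [← Complex.exp_add, real_inner_comm]
    congr 1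
    ring
  · simp
  · simp

/-- The moments of the Gaussian weight as derivatives of its Laplace transform. -/
theorem integral_inner_pow_mul_exp_neg_norm_sq_eq_iteratedDeriv (w : E) (k : ℕ) :
    ∫ v : E, ⟪v, w⟫ ^ k * exp (-‖v‖ ^ 2) =
      π ^ ((finrank ℝ E : ℝ) / 2) *
        iteratedDeriv k (fun c : ℝ ↦ exp (c ^ 2 * ‖w‖ ^ 2 / 4)) 0 := by
  set μ : Measure E := volume.withDensity fun v ↦ ENNReal.ofReal (exp (-‖v‖ ^ 2))
  have hμ (f : E → ℝ) : ∫ v, f v ∂μ = ∫ v, f v * exp (-‖v‖ ^ 2) := by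
    rw [integral_withDensity_eq_integral_toReal_smul (by fun_prop) (by simp)]
    simp [ENNReal.toReal_ofReal (exp_pos _).le, mul_comm]
  have hmgf : mgf (⟪·, w⟫) μ =
      fun c ↦ π ^ ((finrank ℝ E : ℝ) / 2) * exp (c ^ 2 * ‖w‖ ^ 2 / 4) := by
    ext c
    rw [mgf, hμ, integral_exp_mul_inner_mul_exp_neg_norm_sq]
  have hint : integrableExpSet (⟪·, w⟫) μ = univ := by
    refine eq_univ_of_forall fun c ↦ Integrable.of_integral_ne_zero ?_
    have := congrFun hmgf c
    rw [mgf] at this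
    rw [this]
    positivity
  have h := iteratedDeriv_mgf_zero (X := (⟪·, w⟫)) (μ := μ) (by simp [hint]) k
  rw [hmgf, hμ, iteratedDeriv_const_mul_field] at h
  simpa using h.symm

theorem integral_pow_mul_exp_neg_sq_Ioi (k : ℕ) :
    ∫ r in Ioi (0 : ℝ), r ^ k * exp (-r ^ 2) = Gamma ((k + 1) / 2) / 2 := by
  have h := integral_rpow_mul_exp_neg_rpow (p := 2) (q := k) two_pos
    (by linarith [k.cast_nonneg (α := ℝ)])
  simp only [rpow_natCast, rpow_ofNat] at h
  rw [h]
  ring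

theorem integral_rpow_mul_one_sub_rpow {a b : ℝ} (ha : 0 < a) (hb : 0 < b) :
    ∫ x in Ioo (0 : ℝ) 1, x ^ (a - 1) * (1 - x) ^ (b - 1) = beta a b := by
  rw [beta_eq_betaIntegralReal a b ha hb, Complex.betaIntegral,
    intervalIntegral.integral_of_le zero_le_one, ← integral_Ioc_eq_integral_Ioo,
    ← RCLike.re_to_complex, ← integral_re]
  · refine setIntegral_congr_fun measurableSet_Ioc fun x ⟨hx₀, hx₁⟩ ↦ ?_
    norm_cast
    rw [← Complex.ofReal_cpow hx₀.le, ← Complex.ofReal_cpow (by linarith), RCLike.re_to_complex,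
      Complex.re_mul_ofReal, Complex.ofReal_re]
  · exact (intervalIntegrable_iff_integrableOn_Ioc_of_le zero_le_one).1
      (Complex.betaIntegral_convergent (by simpa) (by simpa))

theorem integral_pow_mul_indicator_one_sub_sq_rpow (k : ℕ) {α : ℝ} (hα : 0 < α) :
    ∫ r in Ioi (0 : ℝ), r ^ k * (Iio 1).indicator (fun r ↦ (1 - r ^ 2) ^ (α - 1)) r =
      beta ((k + 1) / 2) α / 2 := by
  rw [← integral_rpow_mul_one_sub_rpow (by positivity) hα, ← integral_div,
    ← Ioi_inter_Iio, ← setIntegral_indicator measurableSet_Iio]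
  symm
  rw [← integral_comp_rpow_Ioi_of_pos two_pos]
  refine setIntegral_congr_fun measurableSet_Ioi fun r (hr : 0 < r) ↦ ?_
  have h : r ^ 2 < 1 ↔ r < 1 := by rw [sq_lt_one_iff₀ hr.le]
  by_cases h1 : r < 1
  · simp only [indicator, mem_Iio, h1, h, if_true, rpow_ofNat, smul_eq_mul]
    have : r ^ k = r * (r ^ 2) ^ (((k : ℝ) + 1) / 2 - 1) := by
      rw [← rpow_natCast r 2, ← rpow_mul hr.le, ← rpow_natCast, mul_comm r, ← rpow_add_one hr.ne']
      push_cast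
      ring_nf
    rw [this]
    norm_num
    ring
  · simp [indicator, h1, h]

/-- The even moments of the Gaussian weight `exp (-‖v‖ ^ 2)`. -/
theorem integral_inner_pow_two_mul_mul_exp_neg_norm_sq (w : E) (m : ℕ) :
    ∫ v : E, ⟪v, w⟫ ^ (2 * m) * exp (-‖v‖ ^ 2) =
      π ^ ((finrank ℝ E : ℝ) / 2) *
        (‖w‖ ^ (2 * m) * ((2 * m).factorial / (4 ^ m * m.factorial))) := by
  rw [integral_inner_pow_mul_exp_neg_norm_sq_eq_iteratedDeriv]
  congr 1
  have h := integral_inner_pow_mul_exp_neg_norm_sq_eq_iteratedDeriv (E := ℝ) ‖w‖ (2 * m)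
  have h' : ∫ v : ℝ, ⟪v, ‖w‖⟫ ^ (2 * m) * exp (-‖v‖ ^ 2) =
      ‖w‖ ^ (2 * m) * Gamma (m + 1 / 2) := by
    have h_abs := integral_comp_abs (f := fun r : ℝ ↦ r ^ (2 * m) * exp (-r ^ 2))
    rw [integral_pow_mul_exp_neg_sq_Ioi] at h_abs
    simp only [RCLike.inner_apply, conj_trivial, mul_pow, mul_assoc, integral_const_mul]
    congr 1
    simp only [pow_mul, sq_abs, norm_eq_abs] at h_abs ⊢
    rw [h_abs]
    push_cast
    ring_nf
  have hdup : Gamma (m + 1 / 2) = √π * ((2 * m).factorial / (4 ^ m * m.factorial)) := by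
    rcases m.eq_zero_or_pos with rfl | hm
    · simp [Gamma_one_half_eq, -one_div]
    have h := Real.Gamma_mul_Gamma_add_half (m + 1 / 2)
    rw [show (m : ℝ) + 1 / 2 + 1 / 2 = m + 1 by ring, Gamma_nat_eq_factorial,
      show 2 * ((m : ℝ) + 1 / 2) = (2 * m : ℕ) + 1 by push_cast; ring, Gamma_nat_eq_factorial,
      show (1 : ℝ) - ((2 * m : ℕ) + 1) = -(2 * m : ℕ) by ring, rpow_neg zero_le_two,
      rpow_natCast, pow_mul] at h
    field_simp
    norm_num at h
    field_simp at h
    linarith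
  rw [h', hdup, norm_norm, finrank_self, Nat.cast_one, ← sqrt_eq_rpow] at h
  have hπ : √π ≠ 0 := by positivity
  refine mul_left_cancel₀ hπ ?_
  rw [← h]
  ring

/-- The even moments of the weight `(1 - ‖y‖ ^ 2) ^ (α - 1)` on the unit ball. -/
theorem setIntegral_inner_pow_two_mul_mul_one_sub_norm_sq_rpow [Nontrivial E] {α : ℝ} (hα : 0 < α)
    (ξ : E) (m : ℕ) :
    ∫ y in {y : E | ‖y‖ < 1}, ⟪y, ξ⟫ ^ (2 * m) * (1 - ‖y‖ ^ 2) ^ (α - 1) =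
      π ^ ((finrank ℝ E : ℝ) / 2) *
        (‖ξ‖ ^ (2 * m) * ((2 * m).factorial / (4 ^ m * m.factorial))) *
          (Gamma α / Gamma (m + α + (finrank ℝ E : ℝ) / 2)) := by
  have hdim : ((finrank ℝ E - 1 + 2 * m : ℕ) + 1 : ℝ) / 2 = m + (finrank ℝ E : ℝ) / 2 := by
    rw [Nat.cast_add, Nat.cast_pred finrank_pos]
    push_cast
    ring
  have hpos : (0 : ℝ) < m + (finrank ℝ E : ℝ) / 2 := by
    have : (0 : ℝ) < finrank ℝ E := Nat.cast_pos.2 finrank_pos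
    positivity
  have hball := integral_inner_pow_mul_fun_norm ξ (2 * m)
    ((Iio 1).indicator fun r : ℝ ↦ (1 - r ^ 2) ^ (α - 1))
  have hgauss := integral_inner_pow_mul_fun_norm ξ (2 * m) fun r : ℝ ↦ exp (-r ^ 2)
  rw [integral_pow_mul_indicator_one_sub_sq_rpow _ hα, hdim] at hball
  rw [integral_inner_pow_two_mul_mul_exp_neg_norm_sq, integral_pow_mul_exp_neg_sq_Ioi,
    hdim] at hgauss
  rw [← integral_indicator (measurableSet_lt measurable_norm measurable_const)]
  convert! hball using 1
  · congr with y
    by_cases h : ‖y‖ < 1 <;> simp [h]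
  · rw [hgauss, beta, show (m : ℝ) + finrank ℝ E / 2 + α = m + α + finrank ℝ E / 2 by ring]
    ring

theorem integrableOn_one_sub_norm_sq_rpow [Nontrivial E] {α : ℝ} (hα : 0 < α) :
    IntegrableOn (fun y : E ↦ (1 - ‖y‖ ^ 2) ^ (α - 1)) {y | ‖y‖ < 1} := by
  refine Integrable.of_integral_ne_zero ?_
  have h := setIntegral_inner_pow_two_mul_mul_one_sub_norm_sq_rpow hα (0 : E) 0
  simp only [mul_zero, pow_zero, one_mul] at h
  rw [h]
  have := Gamma_pos_of_pos hα
  have : 0 < Gamma ((0 : ℕ) + α + (finrank ℝ E : ℝ) / 2) := Gamma_pos_of_pos (by positivity)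
  positivity

/-- The odd moments of a radial weight on the unit ball vanish. -/
theorem setIntegral_inner_pow_mul_fun_norm_eq_zero_of_odd (ξ : E) {k : ℕ} (hk : Odd k)
    (g : ℝ → ℝ) : ∫ y in {y : E | ‖y‖ < 1}, ⟪y, ξ⟫ ^ k * g ‖y‖ = 0 := by
  rw [← integral_indicator (measurableSet_lt measurable_norm measurable_const)]
  refine self_eq_neg.1 ?_
  rw [← integral_neg, ← integral_neg_eq_self]
  congr with y
  by_cases h : ‖y‖ < 1 <;> simp [h, hk.neg_pow]

/-- The expansion of the Laplace transform of `(1 - ‖y‖ ^ 2) ^ (α - 1)` on the unit ball in terms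
of its moments. -/
theorem hasSum_setIntegral_exp_mul_inner_mul_one_sub_norm_sq_rpow [Nontrivial E] {α : ℝ}
    (hα : 0 < α) (c : ℝ) (ξ : E) :
    HasSum
      (fun k : ℕ ↦ c ^ k / k.factorial *
        ∫ y in {y : E | ‖y‖ < 1}, ⟪y, ξ⟫ ^ k * (1 - ‖y‖ ^ 2) ^ (α - 1))
      (∫ y in {y : E | ‖y‖ < 1}, exp (c * ⟪y, ξ⟫) * (1 - ‖y‖ ^ 2) ^ (α - 1)) := by
  have hS : MeasurableSet {y : E | ‖y‖ < 1} := measurableSet_lt measurable_norm measurable_const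
  have hexp (x : ℝ) : HasSum (fun k : ℕ ↦ x ^ k / k.factorial) (exp x) := by
    rw [exp_eq_exp_ℝ]
    exact NormedSpace.expSeries_div_hasSum_exp x
  simp_rw [← integral_const_mul]
  refine hasSum_integral_of_dominated_convergence
    (fun k y ↦ (|c| * ‖ξ‖) ^ k / k.factorial * (1 - ‖y‖ ^ 2) ^ (α - 1))
    (fun k ↦ ?_) (fun k ↦ ?_) (.of_forall fun y ↦ ?_) ?_ (.of_forall fun y ↦ ?_)
  · exact Measurable.aestronglyMeasurable (by fun_prop)
  · filter_upwards [ae_restrict_mem hS] with y (hy : ‖y‖ < 1)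
    have hw : 0 ≤ (1 - ‖y‖ ^ 2) ^ (α - 1) := rpow_nonneg (by nlinarith [norm_nonneg y]) _
    have hin : |⟪y, ξ⟫| ≤ ‖ξ‖ := (abs_real_inner_le_norm y ξ).trans
      (mul_le_of_le_one_left (norm_nonneg ξ) hy.le)
    rw [norm_eq_abs, ← mul_assoc, abs_mul, abs_of_nonneg hw, abs_mul, abs_div, abs_pow, abs_pow,
      Nat.abs_cast, mul_pow, mul_div_right_comm]
    gcongr
  · exact ((hexp _).mul_right _).summable
  · simp_rw [((hexp _).mul_right _).tsum_eq]
    exact (integrableOn_one_sub_norm_sq_rpow hα).const_mul _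
  · convert! (hexp (c * ⟪y, ξ⟫)).mul_right ((1 - ‖y‖ ^ 2) ^ (α - 1)) using 2 with k
    rw [mul_pow]
    ring

end Moments

/-- Evaluation of the Fourier–Laplace transform of the weight `(1-|y|²)^{α-1}` on the unit
ball: `(1/Γ(α)) ∫_{|y|<1} e^{-2⟨y,ξ⟩}(1-|y|²)^{α-1} dy = π^{n/2} ∑ₘ |ξ|^{2m}/(m! Γ(m+α+n/2))`
(a modified Bessel function of the first kind, up to normalization). -/
theorem stmt13 (n : ℕ) (hn : 1 ≤ n) (α : ℝ) (hα : 0 < α) (ξ : EuclideanSpace ℝ (Fin n)) :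
    (1 / Real.Gamma α) *
        ∫ y in {y : EuclideanSpace ℝ (Fin n) | ‖y‖ < 1},
          Real.exp (-2 * ⟪y, ξ⟫) * (1 - ‖y‖ ^ 2) ^ (α - 1) =
      Real.pi ^ ((n : ℝ) / 2) *
        ∑' m : ℕ, ‖ξ‖ ^ (2 * m) / (m.factorial * Real.Gamma (m + α + (n : ℝ) / 2)) := by
  have : Nonempty (Fin n) := ⟨⟨0, hn⟩⟩
  have hΓ : Gamma α ≠ 0 := (Gamma_pos_of_pos hα).ne'
  have h := (hasSum_setIntegral_exp_mul_inner_mul_one_sub_norm_sq_rpow hα (-2) ξ).mul_left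
    (1 / Gamma α)
  rw [← (mul_right_injective₀ (two_ne_zero (α := ℕ))).hasSum_iff] at h
  · rw [← h.tsum_eq, ← tsum_mul_left]
    refine tsum_congr fun m ↦ ?_
    have h4 : ((-2 : ℝ)) ^ (2 * m) = 4 ^ m := by rw [pow_mul]; norm_num
    have hm : ((2 * m).factorial : ℝ) ≠ 0 := by positivity
    rw [Function.comp_apply, setIntegral_inner_pow_two_mul_mul_one_sub_norm_sq_rpow hα,
      finrank_euclideanSpace_fin, h4]
    field_simp
  · intro k hk
    have hodd : Odd k := by
      rw [← Nat.not_even_iff_odd, even_iff_exists_two_mul]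
      rintro ⟨m, rfl⟩
      exact hk ⟨m, rfl⟩
    rw [setIntegral_inner_pow_mul_fun_norm_eq_zero_of_odd ξ hodd fun r ↦ (1 - r ^ 2) ^ (α - 1)]
    simp
end

section
/- Let n ≥ 1 be an integer, λ ∈ ℂ with Re λ > 0 and a > 0. Then for every ξ ∈ ℝⁿ, ∫_{ℝⁿ} e^{-i⟨x,ξ⟩} (a² + |x|²)^{-(λ+n/2)} dx = ( π^{n/2} 2^{-2λ} / Γ(λ+n/2) ) · ∫₀^∞ e^{-a²/(4t)} e^{-t|ξ|²} t^{-λ-1} dt, and both integrals converge absolutely. -/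
open MeasureTheory Real
open scoped RealInnerProductSpace
open Set (Ioi)

section

variable {V : Type*} [NormedAddCommGroup V] [InnerProductSpace ℝ V]

/-- The integrand, on `V × (0, ∞)`, that mediates between the two sides of the subordination
formula. -/
noncomputable def subordinationKernel (s : ℂ) (a : ℝ) (ξ : V) (x : V) (u : ℝ) : ℂ :=
  Complex.exp (-Complex.I * (⟪x, ξ⟫ : ℝ)) *
    ((u : ℂ) ^ (s - 1) * Complex.exp (-(↑(a ^ 2 + ‖x‖ ^ 2) * u)))

theorem norm_subordinationKernel (s : ℂ) (a : ℝ) (ξ x : V) {u : ℝ} (hu : 0 < u) :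
    ‖subordinationKernel s a ξ x u‖ =
      u ^ (s.re - 1) * Real.exp (-a ^ 2 * u) * Real.exp (-u * ‖x‖ ^ 2) := by
  have h₁ : ‖Complex.exp (-Complex.I * (⟪x, ξ⟫ : ℝ))‖ = 1 := by
    rw [Complex.norm_exp]; simp
  rw [subordinationKernel, norm_mul, norm_mul, h₁, Complex.norm_cpow_eq_rpow_re_of_pos hu,
    ← Complex.ofReal_mul, ← Complex.ofReal_neg, Complex.norm_exp_ofReal, one_mul, mul_assoc,
    ← Real.exp_add]
  simp only [Complex.sub_re, Complex.one_re]
  ring_nf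

theorem subordinationKernel_eq (s : ℂ) (a : ℝ) (ξ x : V) (u : ℝ) :
    subordinationKernel s a ξ x u = (u : ℂ) ^ (s - 1) * Complex.exp (-(a ^ 2 * u)) *
      Complex.exp (-u * ‖x‖ ^ 2 + -Complex.I * (⟪ξ, x⟫ : ℝ)) := by
  rw [subordinationKernel, real_inner_comm, mul_left_comm, mul_assoc, ← Complex.exp_add,
    ← Complex.exp_add]
  push_cast
  ring_nf

theorem integral_subordinationKernel_Ioi {s : ℂ} (hs : 0 < s.re) {a : ℝ} (ha : 0 < a) (ξ x : V) :
    ∫ u in Ioi (0 : ℝ), subordinationKernel s a ξ x u =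
      Complex.Gamma s *
        (Complex.exp (-Complex.I * (⟪x, ξ⟫ : ℝ)) * (↑(a ^ 2 + ‖x‖ ^ 2) : ℂ) ^ (-s)) := by
  have hr : 0 < a ^ 2 + ‖x‖ ^ 2 := by positivity
  simp only [subordinationKernel]
  rw [integral_const_mul, Complex.integral_cpow_mul_exp_neg_mul_Ioi hs hr, one_div,
    Complex.inv_cpow _ _ (by rw [Complex.arg_ofReal_of_nonneg hr.le]; exact pi_pos.ne),
    Complex.cpow_neg]
  ring

variable [FiniteDimensional ℝ V] [MeasurableSpace V] [BorelSpace V]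

theorem integral_subordinationKernel_space (lam : ℂ) (a : ℝ) (ξ : V) {u : ℝ} (hu : 0 < u) :
    ∫ x : V, subordinationKernel (lam + (Module.finrank ℝ V : ℂ) / 2) a ξ x u =
      (π : ℂ) ^ ((Module.finrank ℝ V : ℂ) / 2) * ((u : ℂ) ^ (lam - 1) *
        ↑(Real.exp (-(a ^ 2 * u)) * Real.exp (-(‖ξ‖ ^ 2 / (4 * u))))) := by
  have hu' : (u : ℂ) ≠ 0 := by exact_mod_cast hu.ne'
  simp only [subordinationKernel_eq]
  rw [integral_const_mul, GaussianFourier.integral_cexp_neg_mul_sq_norm_add (by simpa),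
    div_eq_mul_inv (π : ℂ), ← Complex.ofReal_inv,
    Complex.mul_cpow_ofReal_nonneg pi_pos.le (by positivity), Complex.ofReal_inv,
    Complex.inv_cpow _ _ (by rw [Complex.arg_ofReal_of_nonneg hu.le]; exact pi_pos.ne),
    show lam + (Module.finrank ℝ V : ℂ) / 2 - 1 = (lam - 1) + (Module.finrank ℝ V : ℂ) / 2 by ring,
    Complex.cpow_add _ _ hu']
  have hne : (u : ℂ) ^ ((Module.finrank ℝ V : ℂ) / 2) ≠ 0 := by simp [Complex.cpow_eq_zero_iff, hu']
  push_cast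
  have : (-Complex.I) ^ 2 * (‖ξ‖ : ℂ) ^ 2 / (4 * u) = -((‖ξ‖ : ℂ) ^ 2 / (4 * u)) := by
    rw [neg_sq, Complex.I_sq]; ring
  rw [this]
  field_simp

theorem integrable_subordinationKernel {lam : ℂ} (hlam : 0 < lam.re) {a : ℝ} (ha : 0 < a) (ξ : V) :
    Integrable (Function.uncurry
      (subordinationKernel (lam + (Module.finrank ℝ V : ℂ) / 2) a ξ))
      ((volume : Measure V).prod (volume.restrict (Ioi 0))) := by
  have hmeas : Measurable (Function.uncurry
      (subordinationKernel (lam + (Module.finrank ℝ V : ℂ) / 2) a ξ)) := by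
    unfold subordinationKernel Function.uncurry
    fun_prop
  rw [integrable_prod_iff' hmeas.aestronglyMeasurable]
  constructor
  · filter_upwards [ae_restrict_mem measurableSet_Ioi] with u hu
    simp only [Function.uncurry_apply_pair, subordinationKernel_eq]
    exact (GaussianFourier.integrable_cexp_neg_mul_sq_norm_add (by simpa) _ _).const_mul _
  · have key := (integrableOn_rpow_mul_exp_neg_mul_rpow (s := lam.re - 1) (p := 1) (b := a ^ 2)
      (by linarith) one_pos (by positivity)).const_mul (π ^ ((Module.finrank ℝ V : ℝ) / 2))
    refine IntegrableOn.congr_fun key (fun u hu ↦ ?_) measurableSet_Ioi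
    have hu : 0 < u := hu
    simp only [Function.uncurry_apply_pair, norm_subordinationKernel _ _ _ _ hu]
    rw [integral_const_mul, GaussianFourier.integral_rexp_neg_mul_sq_norm hu,
      div_rpow pi_pos.le hu.le]
    have : (lam + (Module.finrank ℝ V : ℂ) / 2).re - 1
        = (lam.re - 1) + (Module.finrank ℝ V : ℝ) / 2 := by
      simp; ring
    rw [this, rpow_add hu, rpow_one]
    field_simp

end

theorem exp_subordination_eq_comp_inv (a c : ℝ) :
    (fun t : ℝ ↦ (↑(Real.exp (-(a ^ 2 / (4 * t))) * Real.exp (-(t * c ^ 2))) : ℂ)) =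
      fun t ↦ (fun v : ℝ ↦ (fun u : ℝ ↦
        (↑(Real.exp (-(a ^ 2 * u)) * Real.exp (-(c ^ 2 / (4 * u)))) : ℂ)) (4⁻¹ * v)) t⁻¹ := by
  funext t
  have h₁ : a ^ 2 / (4 * t) = a ^ 2 * (4⁻¹ * t⁻¹) := by rw [div_eq_mul_inv, mul_inv]
  have h₂ : t * c ^ 2 = c ^ 2 / (4 * (4⁻¹ * t⁻¹)) := by
    rw [mul_inv_cancel_left₀ (by norm_num), div_inv_eq_mul, mul_comm]
  simp only [h₁, h₂]

theorem mellin_exp_subordination (lam : ℂ) (a c : ℝ) :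
    mellin (fun t : ℝ ↦ (↑(Real.exp (-(a ^ 2 / (4 * t))) * Real.exp (-(t * c ^ 2))) : ℂ)) (-lam) =
      (2 : ℂ) ^ (2 * lam) * mellin
        (fun u : ℝ ↦ (↑(Real.exp (-(a ^ 2 * u)) * Real.exp (-(c ^ 2 / (4 * u)))) : ℂ)) lam := by
  have h4 : ((4⁻¹ : ℝ) : ℂ) ^ (-lam) = (2 : ℂ) ^ (2 * lam) := by
    rw [show (4⁻¹ : ℝ) = (2 ^ 2)⁻¹ by norm_num, Complex.ofReal_inv,
      Complex.inv_cpow _ _ (by rw [Complex.arg_ofReal_of_nonneg (by positivity)]; exact pi_pos.ne),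
      Complex.cpow_neg, inv_inv, Complex.ofReal_pow, Complex.ofReal_ofNat, two_mul,
      Complex.cpow_add _ _ two_ne_zero, sq, ← Complex.ofReal_ofNat,
      Complex.mul_cpow_ofReal_nonneg (by positivity) (by positivity)]
  rw [exp_subordination_eq_comp_inv, mellin_comp_inv (fun v : ℝ ↦ (fun u : ℝ ↦
    (↑(Real.exp (-(a ^ 2 * u)) * Real.exp (-(c ^ 2 / (4 * u)))) : ℂ)) (4⁻¹ * v)), neg_neg,
    mellin_comp_mul_left (fun u : ℝ ↦
    (↑(Real.exp (-(a ^ 2 * u)) * Real.exp (-(c ^ 2 / (4 * u)))) : ℂ)) _ (by norm_num),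
    smul_eq_mul, h4]

theorem mellinConvergent_exp_subordination {lam : ℂ} (hlam : 0 < lam.re) {a : ℝ} (ha : 0 < a)
    (c : ℝ) :
    MellinConvergent (fun t : ℝ ↦
      (↑(Real.exp (-(a ^ 2 / (4 * t))) * Real.exp (-(t * c ^ 2))) : ℂ)) (-lam) := by
  have key : MellinConvergent (fun u : ℝ ↦
      (↑(Real.exp (-(a ^ 2 * u)) * Real.exp (-(c ^ 2 / (4 * u)))) : ℂ)) lam := by
    have hdom := integrableOn_rpow_mul_exp_neg_mul_rpow (s := lam.re - 1) (p := 1) (b := a ^ 2)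
      (by linarith) one_pos (by positivity)
    refine Integrable.mono' hdom (by fun_prop) ?_
    filter_upwards [ae_restrict_mem measurableSet_Ioi] with u hu
    have hu : 0 < u := hu
    rw [smul_eq_mul, norm_mul, Complex.norm_cpow_eq_rpow_re_of_pos hu, Complex.norm_real,
      Real.norm_of_nonneg (by positivity), rpow_one, neg_mul, Complex.sub_re, Complex.one_re]
    gcongr
    exact mul_le_of_le_one_right (by positivity) (Real.exp_le_one_iff.2 (by simp; positivity))
  rw [exp_subordination_eq_comp_inv]
  have h := (MellinConvergent.comp_rpow (s := -lam) (a := -1) (f := fun v : ℝ ↦ (fun u : ℝ ↦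
    (↑(Real.exp (-(a ^ 2 * u)) * Real.exp (-(c ^ 2 / (4 * u)))) : ℂ)) (4⁻¹ * v)) (by norm_num)).2 (by
      rw [Complex.ofReal_neg, Complex.ofReal_one, div_neg, div_one, neg_neg]
      exact (MellinConvergent.comp_mul_left (by norm_num)).2 key)
  simpa only [rpow_neg_one] using h

/-- Subordination formula for the Fourier transform of `(a²+|x|²)^{-(λ+n/2)}`:
`∫ e^{-i⟨x,ξ⟩}(a²+|x|²)^{-(λ+n/2)} dx = (π^{n/2} 2^{-2λ}/Γ(λ+n/2)) ∫₀^∞ e^{-a²/(4t)} e^{-t|ξ|²} t^{-λ-1} dt`,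
with both integrals absolutely convergent. -/
theorem stmt14 (n : ℕ) (hn : 1 ≤ n) (lam : ℂ) (hlam : 0 < lam.re) (a : ℝ) (ha : 0 < a)
    (ξ : EuclideanSpace ℝ (Fin n)) :
    Integrable (fun x : EuclideanSpace ℝ (Fin n) =>
        Complex.exp (-Complex.I * (⟪x, ξ⟫ : ℝ)) * (↑(a ^ 2 + ‖x‖ ^ 2) : ℂ) ^ (-(lam + (n : ℂ) / 2))) ∧
      IntegrableOn (fun t : ℝ =>
        (↑(Real.exp (-(a ^ 2 / (4 * t))) * Real.exp (-(t * ‖ξ‖ ^ 2))) : ℂ) * (t : ℂ) ^ (-lam - 1))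
        (Set.Ioi 0) ∧
      (∫ x : EuclideanSpace ℝ (Fin n),
          Complex.exp (-Complex.I * (⟪x, ξ⟫ : ℝ)) *
            (↑(a ^ 2 + ‖x‖ ^ 2) : ℂ) ^ (-(lam + (n : ℂ) / 2))) =
        (Real.pi : ℂ) ^ ((n : ℂ) / 2) * (2 : ℂ) ^ (-(2 * lam)) / Complex.Gamma (lam + (n : ℂ) / 2) *
          ∫ t in Set.Ioi (0 : ℝ),
            (↑(Real.exp (-(a ^ 2 / (4 * t))) * Real.exp (-(t * ‖ξ‖ ^ 2))) : ℂ) *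
              (t : ℂ) ^ (-lam - 1) := by
  have hs : 0 < (lam + (n : ℂ) / 2).re := by
    simp only [Complex.add_re, Complex.div_ofNat_re, Complex.natCast_re]
    positivity
  have hΓ : Complex.Gamma (lam + (n : ℂ) / 2) ≠ 0 := Complex.Gamma_ne_zero_of_re_pos hs
  have hint := integrable_subordinationKernel hlam ha ξ
  rw [finrank_euclideanSpace_fin] at hint
  have hcomm (t : ℝ) :
      (↑(Real.exp (-(a ^ 2 / (4 * t))) * Real.exp (-(t * ‖ξ‖ ^ 2))) : ℂ) * (t : ℂ) ^ (-lam - 1) =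
      (t : ℂ) ^ (-lam - 1) •
        (↑(Real.exp (-(a ^ 2 / (4 * t))) * Real.exp (-(t * ‖ξ‖ ^ 2))) : ℂ) := mul_comm _ _
  simp only [hcomm]
  refine ⟨?_, mellinConvergent_exp_subordination hlam ha ‖ξ‖, ?_⟩
  · have h := hint.integral_prod_left.const_mul (Complex.Gamma (lam + (n : ℂ) / 2))⁻¹
    simpa only [Function.uncurry_apply_pair, integral_subordinationKernel_Ioi hs ha,
      inv_mul_cancel_left₀ hΓ] using h
  · change _ = _ * mellin (fun t : ℝ ↦
      (↑(Real.exp (-(a ^ 2 / (4 * t))) * Real.exp (-(t * ‖ξ‖ ^ 2))) : ℂ)) (-lam)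
    have hswap := integral_integral_swap hint
    simp only [integral_subordinationKernel_Ioi hs ha] at hswap
    have hspace : ∫ u in Ioi (0 : ℝ), ∫ x, subordinationKernel (lam + (n : ℂ) / 2) a ξ x u =
        (π : ℂ) ^ ((n : ℂ) / 2) * mellin (fun u : ℝ ↦
          (↑(Real.exp (-(a ^ 2 * u)) * Real.exp (-(‖ξ‖ ^ 2 / (4 * u)))) : ℂ)) lam := by
      rw [mellin, ← integral_const_mul]
      refine setIntegral_congr_fun measurableSet_Ioi fun u hu ↦ ?_
      simpa only [finrank_euclideanSpace_fin, smul_eq_mul] using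
        integral_subordinationKernel_space lam a ξ hu
    rw [hspace, integral_const_mul] at hswap
    have h2 : (2 : ℂ) ^ (2 * lam) ≠ 0 := by simp [Complex.cpow_eq_zero_iff]
    rw [mellin_exp_subordination, Complex.cpow_neg, div_mul_eq_mul_div, eq_div_iff hΓ, mul_comm,
      hswap, mul_assoc, inv_mul_cancel_left₀ h2]
end

section
/- Let n ≥ 1 be an integer, s > 0 and α > max{2s − (n+1)/2, 0}. Then the function W(r) := G(r)² S(r) is strictly decreasing on (0,∞), and lim_{r → 0⁺} W(r) = Γ(s)² / Γ(α + n/2). -/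
open MeasureTheory Real Filter

/-- `G(r) = ∫₀^∞ e^{-t - r²/(4t)} t^{s-1} dt` (so `G(r) = 2^{1-s} r^s K_s(r)`). -/
noncomputable def G (s : ℝ) (r : ℝ) : ℝ :=
  ∫ t in Set.Ioi (0 : ℝ), Real.exp (-t - r ^ 2 / (4 * t)) * t ^ (s - 1)

/-- `S(r) = ∑ₘ r^{2m}/(m! Γ(m+α+n/2))` (so `S(r) = 2^{α+n/2-1} I_{α+n/2-1}(2r)/(2r)^{α+n/2-1}`). -/
noncomputable def S (n : ℕ) (α : ℝ) (r : ℝ) : ℝ :=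
  ∑' m : ℕ, r ^ (2 * m) / (m.factorial * Real.Gamma (m + α + (n : ℝ) / 2))

lemma exists_kernel_le (s : ℝ) {r : ℝ} (hr : 0 < r) :
    ∃ C p : ℝ, 0 < p ∧ ∀ t : ℝ, 0 < t →
      exp (-t - r ^ 2 / (4 * t)) * t ^ s ≤ C * (exp (-t) * t ^ p) := by
  obtain ⟨k, hk⟩ := exists_nat_gt (-s)
  refine ⟨k.factorial * (4 / r ^ 2) ^ k, s + k, by linarith, fun t ht => ?_⟩
  have h := Real.pow_div_factorial_le_exp (r ^ 2 / (4 * t)) (by positivity) k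
  have h2 : exp (-(r ^ 2 / (4 * t))) ≤ k.factorial * (4 / r ^ 2) ^ k * t ^ k := by
    rw [exp_neg]
    apply inv_le_of_inv_le₀ (by positivity)
    refine le_trans (le_of_eq ?_) h
    have hq : r ^ 2 / (4 * t) = (4 / r ^ 2 * t)⁻¹ := by field_simp
    rw [hq, mul_assoc, ← mul_pow, mul_inv, inv_pow]
    ring
  rw [sub_eq_add_neg, exp_add, rpow_add ht, rpow_natCast]
  calc exp (-t) * exp (-(r ^ 2 / (4 * t))) * t ^ s
      ≤ exp (-t) * (k.factorial * (4 / r ^ 2) ^ k * t ^ k) * t ^ s := by gcongr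
    _ = _ := by ring

lemma continuousOn_kernel (s r : ℝ) :
    ContinuousOn (fun t : ℝ => exp (-t - r ^ 2 / (4 * t)) * t ^ s) (Set.Ioi 0) := by
  intro t ht
  have ht' : t ≠ 0 := ne_of_gt ht
  apply ContinuousAt.continuousWithinAt
  have : 4 * t ≠ 0 := by simpa using ht'
  exact ContinuousAt.mul (by fun_prop (disch := assumption))
    (continuousAt_rpow_const _ _ (Or.inl ht'))

lemma aestronglyMeasurable_kernel (s r : ℝ) :
    AEStronglyMeasurable (fun t : ℝ => exp (-t - r ^ 2 / (4 * t)) * t ^ s)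
      (volume.restrict (Set.Ioi 0)) :=
  (continuousOn_kernel s r).aestronglyMeasurable measurableSet_Ioi

lemma integrableOn_kernel (s : ℝ) {r : ℝ} (hr : 0 < r) :
    IntegrableOn (fun t : ℝ => exp (-t - r ^ 2 / (4 * t)) * t ^ s) (Set.Ioi 0) := by
  obtain ⟨C, p, hp, h⟩ := exists_kernel_le s hr
  have hi := (Real.GammaIntegral_convergent (s := p + 1) (by linarith)).const_mul C
  refine Integrable.mono' hi (aestronglyMeasurable_kernel s r) ?_
  filter_upwards [ae_restrict_mem measurableSet_Ioi] with t ht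
  have ht' : 0 < t := ht
  rw [norm_of_nonneg (by positivity), add_sub_cancel_right]
  exact h t ht

lemma G_pos (s : ℝ) {r : ℝ} (hr : 0 < r) : 0 < G s r := by
  unfold G
  rw [setIntegral_pos_iff_support_of_nonneg_ae _ (integrableOn_kernel _ hr)]
  · have : Set.Ioi (0 : ℝ) ⊆ Function.support
        (fun t : ℝ => exp (-t - r ^ 2 / (4 * t)) * t ^ (s - 1)) := fun t ht => by
      have ht' : 0 < t := ht
      simp only [Function.mem_support]
      positivity
    rw [Set.inter_eq_right.2 this]
    simp
  · filter_upwards [ae_restrict_mem measurableSet_Ioi] with t ht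
    have ht' : 0 < t := ht
    simp only [Pi.zero_apply]
    positivity

lemma hasDerivAt_G (s : ℝ) {r : ℝ} (hr : 0 < r) :
    HasDerivAt (G s) (-(r / 2) * G (s - 1) r) r := by
  have hb : Integrable (fun t : ℝ => r * (exp (-t - (r / 2) ^ 2 / (4 * t)) * t ^ (s - 1 - 1)))
      (volume.restrict (Set.Ioi 0)) := (integrableOn_kernel _ (half_pos hr)).const_mul r
  have key := hasDerivAt_integral_of_dominated_loc_of_deriv_le (x₀ := r)
    (μ := volume.restrict (Set.Ioi (0 : ℝ)))
    (F := fun r t => exp (-t - r ^ 2 / (4 * t)) * t ^ (s - 1))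
    (F' := fun r t => -(r / 2) * (exp (-t - r ^ 2 / (4 * t)) * t ^ (s - 1 - 1)))
    (s := Set.Ioo (r / 2) (2 * r))
    (Ioo_mem_nhds (by linarith) (by linarith))
    (Eventually.of_forall fun r => aestronglyMeasurable_kernel _ _)
    (integrableOn_kernel _ hr)
    ((aestronglyMeasurable_kernel _ _).const_mul _) ?_ hb ?_
  · have h := key.2
    rw [integral_const_mul] at h
    exact h
  · filter_upwards [ae_restrict_mem measurableSet_Ioi] with t ht x hx
    have ht' : 0 < t := ht
    have hx0 : 0 < x := by linarith [hx.1]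
    rw [norm_mul, norm_neg, norm_of_nonneg (by positivity), norm_of_nonneg (by positivity)]
    have h1 : r / 2 ≤ x := hx.1.le
    have h2 : x / 2 ≤ r := by linarith [hx.2]
    gcongr
  · filter_upwards [ae_restrict_mem measurableSet_Ioi] with t ht x hx
    have ht' : 0 < t := ht
    have h1 : HasDerivAt (fun x : ℝ => -t - x ^ 2 / (4 * t)) (-(2 * x / (4 * t))) x := by
      simpa using ((hasDerivAt_pow 2 x).div_const (4 * t)).const_sub (-t)
    refine (h1.exp.mul_const (t ^ (s - 1))).congr_deriv ?_
    rw [rpow_sub_one ht'.ne' (s - 1)]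
    field_simp
    ring

lemma tendsto_kernel_atTop (s : ℝ) {r : ℝ} (hr : 0 < r) :
    Tendsto (fun t : ℝ => exp (-t - r ^ 2 / (4 * t)) * t ^ s) atTop (nhds 0) := by
  obtain ⟨C, p, hp, h⟩ := exists_kernel_le s hr
  have h0 := (tendsto_rpow_mul_exp_neg_mul_atTop_nhds_zero p 1 one_pos).const_mul C
  rw [mul_zero] at h0
  refine squeeze_zero' ?_ ?_ h0
  · filter_upwards [eventually_gt_atTop 0] with t ht
    positivity
  · filter_upwards [eventually_gt_atTop 0] with t ht
    simpa [mul_comm] using h t ht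

lemma tendsto_kernel_zero (s : ℝ) {r : ℝ} (hr : 0 < r) :
    Tendsto (fun t : ℝ => exp (-t - r ^ 2 / (4 * t)) * t ^ s) (nhdsWithin 0 (Set.Ioi 0))
      (nhds 0) := by
  obtain ⟨C, p, hp, h⟩ := exists_kernel_le s hr
  have h0 : Tendsto (fun t : ℝ => C * (exp (-t) * t ^ p)) (nhdsWithin 0 (Set.Ioi 0))
      (nhds 0) := by
    have : ContinuousAt (fun t : ℝ => C * (exp (-t) * t ^ p)) 0 :=
      continuousAt_const.mul
        ((by fun_prop : ContinuousAt (fun t : ℝ => exp (-t)) 0).mul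
          (continuousAt_rpow_const _ _ (Or.inr hp.le)))
    have h2 := this.tendsto.mono_left (nhdsWithin_le_nhds (s := Set.Ioi 0))
    simpa [zero_rpow hp.ne'] using h2
  refine squeeze_zero' ?_ ?_ h0
  · filter_upwards [self_mem_nhdsWithin] with t ht
    have ht' : 0 < t := ht
    positivity
  · filter_upwards [self_mem_nhdsWithin] with t ht
    exact h t ht

lemma G_add_one (s : ℝ) {r : ℝ} (hr : 0 < r) :
    G (s + 1) r = s * G s r + r ^ 2 / 4 * G (s - 1) r := by
  have h1 := integrableOn_kernel (s + 1 - 1) hr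
  have h2 := integrableOn_kernel (s - 1) hr
  have h3 := integrableOn_kernel (s - 1 - 1) hr
  have hd : ∀ t ∈ Set.Ioi (0 : ℝ), HasDerivAt (fun t : ℝ => exp (-t - r ^ 2 / (4 * t)) * t ^ s)
      (s * (exp (-t - r ^ 2 / (4 * t)) * t ^ (s - 1)) +
        r ^ 2 / 4 * (exp (-t - r ^ 2 / (4 * t)) * t ^ (s - 1 - 1)) -
        exp (-t - r ^ 2 / (4 * t)) * t ^ (s + 1 - 1)) t := by
    intro t ht
    have ht' : 0 < t := ht
    have hu : HasDerivAt (fun t : ℝ => -t - r ^ 2 / (4 * t)) (-1 + r ^ 2 / (4 * t ^ 2)) t := by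
      have h4 : HasDerivAt (fun t : ℝ => 4 * t) 4 t := by
        simpa using (hasDerivAt_id t).const_mul (4 : ℝ)
      refine ((hasDerivAt_id t).neg.sub
        ((hasDerivAt_const t (r ^ 2)).div h4 (by positivity))).congr_deriv ?_
      field_simp
      ring
    refine (hu.exp.mul (hasDerivAt_rpow_const (p := s) (Or.inl ht'.ne'))).congr_deriv ?_
    rw [rpow_sub_one ht'.ne' (s - 1), rpow_sub_one ht'.ne' s, add_sub_cancel_right]
    field_simp
    ring
  have hi := ((h2.const_mul s).add (h3.const_mul (r ^ 2 / 4))).sub h1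
  have hone : ∀ f : ℝ → ℝ, (f * fun _ => 1) = f := fun f => by ext; simp
  have hzero : ∀ f : ℝ → ℝ, (f * fun _ => 0) = 0 := fun f => by ext; simp
  have key := integral_Ioi_deriv_mul_eq_sub hd (v := fun _ => 1) (v' := fun _ => 0)
    (fun t _ => hasDerivAt_const t 1) (by rw [hone, hzero, add_zero]; exact hi)
    (a' := 0) (b' := 0) (by rw [hone]; exact tendsto_kernel_zero s hr)
    (by rw [hone]; exact tendsto_kernel_atTop s hr)
  simp only [mul_one, mul_zero, add_zero, sub_zero] at key
  rw [integral_sub (f := fun t : ℝ => s * (exp (-t - r ^ 2 / (4 * t)) * t ^ (s - 1)) +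
        r ^ 2 / 4 * (exp (-t - r ^ 2 / (4 * t)) * t ^ (s - 1 - 1)))
      ((h2.const_mul s).add (h3.const_mul (r ^ 2 / 4))) h1,
    integral_add (h2.const_mul s) (h3.const_mul (r ^ 2 / 4)), integral_const_mul,
    integral_const_mul] at key
  unfold G
  linarith

lemma tendsto_G_zero {s : ℝ} (hs : 0 < s) :
    Tendsto (G s) (nhdsWithin 0 (Set.Ioi 0)) (nhds (Gamma s)) := by
  rw [Gamma_eq_integral hs]
  refine tendsto_integral_filter_of_dominated_convergence
    (fun t => exp (-t) * t ^ (s - 1)) ?_ ?_ (GammaIntegral_convergent hs) ?_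
  · exact Eventually.of_forall fun r => aestronglyMeasurable_kernel _ _
  · refine Eventually.of_forall fun r => ?_
    filter_upwards [ae_restrict_mem measurableSet_Ioi] with t ht
    have ht' : 0 < t := ht
    rw [norm_of_nonneg (by positivity)]
    gcongr
    have : 0 ≤ r ^ 2 / (4 * t) := by positivity
    linarith
  · refine Eventually.of_forall fun t => ?_
    refine Tendsto.mono_left ?_ nhdsWithin_le_nhds
    have : ContinuousAt (fun r : ℝ => exp (-t - r ^ 2 / (4 * t)) * t ^ (s - 1)) 0 := by
      fun_prop
    simpa using this.tendsto

/-- The entire function `y ↦ ∑ₘ yᵐ / (m! Γ(m + β))`. -/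
noncomputable def besselSeries (β y : ℝ) : ℝ :=
  ∑' m : ℕ, y ^ m / (m.factorial * Gamma (m + β))

lemma Gamma_natCast_add_pos {β : ℝ} (hβ : 0 < β) (m : ℕ) : 0 < Gamma (m + β) :=
  Gamma_pos_of_pos (by positivity)

lemma summable_besselSeries {β : ℝ} (hβ : 0 < β) (y : ℝ) :
    Summable fun m : ℕ => y ^ m / (m.factorial * Gamma (m + β)) := by
  rcases eq_or_ne y 0 with rfl | hy
  · refine summable_of_ne_finset_zero (s := {0}) fun m hm => ?_
    have : m ≠ 0 := by simpa using hm
    simp [this]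
  refine summable_of_ratio_test_tendsto_lt_one (l := 0) one_pos ?_ ?_
  · refine Eventually.of_forall fun m => ?_
    have := Gamma_natCast_add_pos hβ m
    positivity
  · have h1 : Tendsto (fun m : ℕ => (m : ℝ) + 1) atTop atTop :=
      tendsto_atTop_add_const_right _ _ tendsto_natCast_atTop_atTop
    have h2 : Tendsto (fun m : ℕ => (m : ℝ) + β) atTop atTop :=
      tendsto_atTop_add_const_right _ _ tendsto_natCast_atTop_atTop
    refine ((h1.atTop_mul_atTop₀ h2).const_div_atTop |y|).congr fun m => ?_
    have hG := Gamma_natCast_add_pos hβ m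
    have hm : (0 : ℝ) < m + β := by positivity
    have hrec : Gamma (((m + 1 : ℕ) : ℝ) + β) = (m + β) * Gamma (m + β) := by
      rw [← Gamma_add_one hm.ne']
      push_cast
      ring_nf
    rw [hrec, Nat.factorial_succ]
    simp only [norm_div, norm_mul, norm_pow, norm_eq_abs, abs_of_pos hG, abs_of_pos hm,
      Nat.abs_cast]
    push_cast
    have hy' : 0 < |y| := abs_pos.2 hy
    field_simp
    ring

lemma besselSeries_pos {β y : ℝ} (hβ : 0 < β) (hy : 0 ≤ y) : 0 < besselSeries β y := by
  refine (summable_besselSeries hβ y).tsum_pos (fun m => ?_) 0 ?_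
  · have := Gamma_natCast_add_pos hβ m
    positivity
  · have := Gamma_pos_of_pos hβ
    simpa using this

lemma besselSeries_zero (β : ℝ) : besselSeries β 0 = 1 / Gamma β := by
  unfold besselSeries
  rw [tsum_eq_single 0 fun m hm => by simp [hm]]
  simp

lemma natCast_mul_div_factorial (β y : ℝ) (m : ℕ) :
    ((m + 1 : ℕ) : ℝ) * y ^ (m + 1 - 1) / ((m + 1).factorial * Gamma ((m + 1 : ℕ) + β)) =
      y ^ m / (m.factorial * Gamma (m + (β + 1))) := by
  have h : ((m + 1 : ℕ) : ℝ) + β = m + (β + 1) := by push_cast; ring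
  rw [h, Nat.factorial_succ, Nat.add_sub_cancel, Nat.cast_mul, mul_assoc,
    mul_div_mul_left _ _ (by positivity)]

lemma hasDerivAt_besselSeries {β : ℝ} (hβ : 0 < β) (y : ℝ) :
    HasDerivAt (besselSeries β) (besselSeries (β + 1) y) y := by
  have hβ' : 0 < β + 1 := by linarith
  have hs : ∀ y : ℝ, Summable fun m : ℕ =>
      (m : ℝ) * y ^ (m - 1) / (m.factorial * Gamma (m + β)) := fun y => by
    rw [← summable_nat_add_iff 1]
    simpa only [natCast_mul_div_factorial] using summable_besselSeries hβ' y
  have key := hasDerivAt_tsum_of_isPreconnected (y := y) (y₀ := y)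
    (g := fun (m : ℕ) (y : ℝ) => y ^ m / (m.factorial * Gamma (m + β)))
    (g' := fun (m : ℕ) (y : ℝ) => (m : ℝ) * y ^ (m - 1) / (m.factorial * Gamma (m + β)))
    (hs (|y| + 1)) Metric.isOpen_ball (convex_ball (0 : ℝ) (|y| + 1)).isPreconnected
    (fun m z _ => (hasDerivAt_pow m z).div_const _) (fun m z hz => ?_)
    (by simp) (summable_besselSeries hβ y) (by simp)
  · refine key.congr_deriv ?_
    rw [(hs y).tsum_eq_zero_add]
    simp only [natCast_mul_div_factorial]
    simp [besselSeries]
  · have hG := Gamma_natCast_add_pos hβ m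
    have hz' : |z| ≤ |y| + 1 := by simpa using (mem_ball_zero_iff.1 hz).le
    simp only [norm_div, norm_mul, norm_pow, norm_eq_abs, abs_of_pos hG, Nat.abs_cast]
    gcongr

lemma besselSeries_eq {β : ℝ} (hβ : 0 < β) (y : ℝ) :
    besselSeries β y = β * besselSeries (β + 1) y + y * besselSeries (β + 1 + 1) y := by
  have hβ' : 0 < β + 1 := by linarith
  have h1 := (summable_besselSeries hβ' y).mul_left β
  have h2 := (summable_besselSeries (β := β + 1 + 1) (by linarith) y).mul_left y
  have hterm : ∀ m : ℕ, y * (y ^ m / (m.factorial * Gamma (m + (β + 1 + 1)))) =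
      ((m + 1 : ℕ) : ℝ) * y ^ (m + 1) / ((m + 1).factorial * Gamma ((m + 1 : ℕ) + (β + 1))) :=
    fun m => by
      rw [← natCast_mul_div_factorial, Nat.add_sub_cancel, pow_succ]
      ring
  have h3 : Summable fun m : ℕ =>
      (m : ℝ) * y ^ m / (m.factorial * Gamma (m + (β + 1))) := by
    rw [← summable_nat_add_iff 1]
    exact h2.congr hterm
  have h4 : y * besselSeries (β + 1 + 1) y =
      ∑' m : ℕ, (m : ℝ) * y ^ m / (m.factorial * Gamma (m + (β + 1))) := by
    rw [h3.tsum_eq_zero_add, besselSeries, ← tsum_mul_left, tsum_congr hterm]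
    simp
  rw [h4, besselSeries, besselSeries, ← tsum_mul_left, ← h1.tsum_add h3]
  refine tsum_congr fun m => ?_
  have hm : (0 : ℝ) < m + β := by positivity
  have hG := Gamma_natCast_add_pos hβ m
  rw [← add_assoc, Gamma_add_one hm.ne']
  field_simp
  ring

/-- A Turán-type inequality for consecutive Bessel series, equivalent to the Amos upper bound
for the ratio `I_β / I_{β - 1}`. -/
lemma besselSeries_sq_lt {β y : ℝ} (hβ : 1 / 2 < β) (hy : 0 < y) :
    (β - 1 / 2) * (besselSeries β y * besselSeries (β + 1) y) + y * besselSeries (β + 1) y ^ 2 <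
      besselSeries β y ^ 2 := by
  have hβ0 : 0 < β := by linarith
  have hβ1 : 0 < β + 1 := by linarith
  set b := β - 1 / 2 with hb
  have hb0 : 0 < b := by linarith
  set N : ℝ → ℝ := fun y => besselSeries β y ^ 2 -
    b * (besselSeries β y * besselSeries (β + 1) y) - y * besselSeries (β + 1) y ^ 2 with hN
  have hNd : ∀ y, HasDerivAt N (2 * besselSeries β y * besselSeries (β + 1) y -
      b * (besselSeries (β + 1) y * besselSeries (β + 1) y +
        besselSeries β y * besselSeries (β + 1 + 1) y) -
      (besselSeries (β + 1) y ^ 2 +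
        y * (2 * besselSeries (β + 1) y * besselSeries (β + 1 + 1) y))) y := by
    intro y
    have h0 := hasDerivAt_besselSeries hβ0 y
    have h1 := hasDerivAt_besselSeries hβ1 y
    refine (((h0.pow 2).sub ((h0.mul h1).const_mul b)).sub
      ((hasDerivAt_id y).mul (h1.pow 2))).congr_deriv ?_
    simp
  have hmono : StrictMonoOn (fun y : ℝ => y ^ b * N y) (Set.Ici 0) := by
    refine strictMonoOn_of_deriv_pos (convex_Ici 0) ?_ ?_
    · intro z hz
      exact ((continuousAt_rpow_const _ _ (Or.inr hb0.le)).mul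
        (hNd z).continuousAt).continuousWithinAt
    · intro z hz
      rw [interior_Ici] at hz
      have hz0 : 0 < z := hz
      have hd : HasDerivAt (fun y : ℝ => y ^ b * N y) _ z :=
        (hasDerivAt_rpow_const (p := b) (Or.inl hz0.ne')).mul (hNd z)
      rw [hd.deriv]
      have hrec := besselSeries_eq hβ0 z
      have p0 := besselSeries_pos hβ0 hz0.le
      have p1 := besselSeries_pos hβ1 hz0.le
      have hpow : z ^ b = z ^ (b - 1) * z := by
        rw [rpow_sub_one hz0.ne']
        field_simp
      have hzb : 0 < z ^ (b - 1) := by positivity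
      have hval : 0 < z ^ (b - 1) * (b / 2 * (besselSeries β z * besselSeries (β + 1) z)) := by
        positivity
      refine lt_of_lt_of_eq hval ?_
      rw [hpow]
      simp only [hN]
      have hβb : β = b + 1 / 2 := by rw [hb]; ring
      generalize besselSeries β z = A at *
      generalize besselSeries (β + 1) z = B at *
      generalize besselSeries (β + 1 + 1) z = C at *
      generalize z ^ (b - 1) = Z at *
      have hA : z * C = A - (b + 1 / 2) * B := by rw [← hβb]; linarith
      linear_combination Z * (b * A + 2 * z * B) * hA
  have h := hmono (Set.mem_Ici.2 le_rfl) (Set.mem_Ici.2 hy.le) hy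
  simp only [zero_rpow hb0.ne', zero_mul] at h
  have hNy : 0 < N y := pos_of_mul_pos_right h (by positivity)
  simp only [hN] at hNy
  linarith

lemma S_eq_besselSeries (n : ℕ) (α r : ℝ) :
    S n α r = besselSeries (α + (n : ℝ) / 2) (r ^ 2) := by
  unfold S besselSeries
  refine tsum_congr fun m => ?_
  rw [pow_mul, add_assoc]

/-- The logarithmic derivative of `1 / G` exceeds any `c > 0` below the positive root of
`x ^ 2 + (2s - 1) x / r = 1`. -/
lemma mul_G_lt {s b c r₀ : ℝ} (hr₀ : 0 < r₀) (hc : 0 < c) (hb : 0 < b) (hsb : 2 * s - 1 ≤ b)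
    (hcb : c ^ 2 + b * c / r₀ < 1) : c * G s r₀ < r₀ / 2 * G (s - 1) r₀ := by
  by_contra! hcon
  set g : ℝ → ℝ := fun r => r / 2 * G (s - 1) r / G s r with hg
  have hgd : ∀ r, 0 < r → HasDerivAt g (g r ^ 2 + (2 * s - 1) * g r / r - 1) r := by
    intro r hr
    have h0 := hasDerivAt_G s hr
    have h1 := hasDerivAt_G (s - 1) hr
    have hrec := G_add_one (s - 1) hr
    rw [sub_add_cancel] at hrec
    have hpos := G_pos s hr
    refine ((((hasDerivAt_id r).div_const 2).mul h1).div h0 hpos.ne').congr_deriv ?_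
    simp only [hg, id, Pi.mul_apply]
    have hC : r ^ 2 * G (s - 1 - 1) r = 4 * (G s r - (s - 1) * G (s - 1) r) := by linarith
    generalize G s r = A at *
    generalize G (s - 1) r = B at *
    generalize G (s - 1 - 1) r = C at *
    field_simp
    linear_combination (-A) * hC
  have hgpos : ∀ r, 0 < r → 0 < g r := fun r hr => by
    have h0 := G_pos s hr
    have h1 := G_pos (s - 1) hr
    simp only [hg]
    positivity
  obtain ⟨δ, hδ, hδ'⟩ : ∃ δ > 0, c ^ 2 + b * c / r₀ - 1 < -δ :=
    ⟨(1 - (c ^ 2 + b * c / r₀)) / 2, by linarith, by linarith⟩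
  have hle : r₀ ≤ r₀ + c / δ := by
    have : 0 < c / δ := by positivity
    linarith
  have hbound := image_le_of_deriv_right_lt_deriv_boundary' (f := g)
    (a := r₀) (b := r₀ + c / δ) (B := fun r => c - δ * (r - r₀)) (B' := fun _ => -δ)
    (fun r hr => (hgd r (hr₀.trans_le hr.1)).continuousAt.continuousWithinAt)
    (fun r hr => (hgd r (hr₀.trans_le hr.1)).hasDerivWithinAt)
    (by simpa [hg, div_le_iff₀ (G_pos s hr₀)] using hcon)
    (by fun_prop)
    (fun r _ => by
      have := (((hasDerivAt_id r).sub_const r₀).const_mul δ).const_sub c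
      simpa using! this.hasDerivWithinAt)
    (fun r hr heq => ?_) (Set.right_mem_Icc.2 hle)
  · have h := hgpos (r₀ + c / δ) (hr₀.trans_le hle)
    have : δ * (r₀ + c / δ - r₀) = c := by field_simp; ring
    linarith
  · have hr0 : 0 < r := hr₀.trans_le hr.1
    have hgr := hgpos r hr0
    have hgc : g r ≤ c := by
      have : 0 ≤ δ * (r - r₀) := mul_nonneg hδ.le (by linarith [hr.1])
      linarith
    have h1 : g r ^ 2 ≤ c ^ 2 := by gcongr
    have h2 : (2 * s - 1) * g r / r ≤ b * c / r₀ := by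
      calc (2 * s - 1) * g r / r ≤ b * g r / r := by gcongr
        _ ≤ b * c / r₀ := by gcongr; exact hr.1
    linarith

/-- For `α > max (2s-(n+1)/2) 0` the weight `W = G² S` is strictly decreasing on `(0,∞)`
and `W(r) → Γ(s)²/Γ(α+n/2)` as `r → 0⁺`. -/
theorem stmt15 (n : ℕ) (hn : 1 ≤ n) (s : ℝ) (hs : 0 < s) (α : ℝ)
    (hα : α > max (2 * s - ((n : ℝ) + 1) / 2) 0) :
    StrictAntiOn (fun r : ℝ => G s r ^ 2 * S n α r) (Set.Ioi 0) ∧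
      Tendsto (fun r : ℝ => G s r ^ 2 * S n α r) (nhdsWithin 0 (Set.Ioi 0))
        (nhds (Real.Gamma s ^ 2 / Real.Gamma (α + (n : ℝ) / 2))) := by
  obtain ⟨hα1, hα0⟩ := max_lt_iff.1 hα
  have hn' : (1 : ℝ) ≤ n := by exact_mod_cast hn
  simp only [S_eq_besselSeries]
  set β := α + (n : ℝ) / 2 with hβ
  have hβh : 1 / 2 < β := by linarith
  have hβ0 : 0 < β := by linarith
  have hd : ∀ r : ℝ, 0 < r → HasDerivAt (fun r : ℝ => G s r ^ 2 * besselSeries β (r ^ 2))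
      (r * G s r * (2 * G s r * besselSeries (β + 1) (r ^ 2) -
        G (s - 1) r * besselSeries β (r ^ 2))) r := by
    intro r hr
    have hB : HasDerivAt (fun r : ℝ => besselSeries β (r ^ 2))
        (besselSeries (β + 1) (r ^ 2) * (2 * r)) r :=
      HasDerivAt.comp (h₂ := besselSeries β) (h := fun r : ℝ => r ^ 2) r
        (hasDerivAt_besselSeries hβ0 (r ^ 2)) (by simpa using hasDerivAt_pow 2 r)
    refine (((hasDerivAt_G s hr).pow 2).mul hB).congr_deriv ?_
    simp only [Pi.pow_apply]
    push_cast
    ring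
  constructor
  · refine strictAntiOn_of_deriv_neg (convex_Ioi 0)
      (fun r hr => (hd r hr).continuousAt.continuousWithinAt) fun r hr => ?_
    rw [interior_Ioi] at hr
    have hr0 : 0 < r := hr
    rw [(hd r hr0).deriv]
    have p0 := besselSeries_pos hβ0 (sq_nonneg r)
    have p1 := besselSeries_pos (β := β + 1) (by linarith) (sq_nonneg r)
    have hT := besselSeries_sq_lt hβh (pow_pos hr0 2)
    have hlt := mul_G_lt (s := s) (b := β - 1 / 2)
      (c := r * besselSeries (β + 1) (r ^ 2) / besselSeries β (r ^ 2)) hr0 (by positivity)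
      (by linarith) (by linarith) (by
        refine lt_of_eq_of_lt ?_ ((div_lt_one (pow_pos p0 2)).2 hT)
        field_simp
        ring)
    refine mul_neg_of_pos_of_neg (mul_pos hr0 (G_pos s hr0)) ?_
    rw [div_mul_eq_mul_div, div_lt_iff₀ p0] at hlt
    have : r * (2 * G s r * besselSeries (β + 1) (r ^ 2)) <
        r * (G (s - 1) r * besselSeries β (r ^ 2)) := by linarith
    linarith [lt_of_mul_lt_mul_left this hr0.le]
  · have hB : ContinuousAt (fun r : ℝ => besselSeries β (r ^ 2)) 0 :=
      ContinuousAt.comp (hasDerivAt_besselSeries hβ0 _).continuousAt (by fun_prop)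
    have hB' := hB.tendsto.mono_left (nhdsWithin_le_nhds (s := Set.Ioi 0))
    rw [zero_pow two_ne_zero, besselSeries_zero] at hB'
    rw [div_eq_mul_one_div]
    exact ((tendsto_G_zero hs).pow 2).mul hB'
end

section
/- Let n ≥ 1 be an integer, s > 0 and α > 0. Then there exist constants 0 < c₁ ≤ c₂ (depending only on n, s, α) such that for all r > 0: c₁ (1+r)^{2s − α − (n+1)/2} ≤ G(r)² S(r) ≤ c₂ (1+r)^{2s − α − (n+1)/2}. -/
open MeasureTheory Real

section

open Filter Topology Asymptotics Set
open scoped Nat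

theorem Gamma_nat_add_one_add {β : ℝ} (hβ : 0 < β) (m : ℕ) :
    Real.Gamma (m + 1 + β) = Real.Gamma β * ∏ j ∈ Finset.range (m + 1), (β + j) := by
  induction m with
  | zero => simp [add_comm (1 : ℝ), Real.Gamma_add_one hβ.ne', mul_comm]
  | succ k ih =>
    rw [Finset.prod_range_succ, ← mul_assoc, ← ih]
    push_cast
    rw [show (k : ℝ) + 1 + 1 + β = (k + 1 + β) + 1 by ring,
      Real.Gamma_add_one (by positivity)]
    ring

theorem Gamma_nat_add_isTheta {β : ℝ} (hβ : 0 < β) :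
    (fun m : ℕ => Real.Gamma (m + β)) =Θ[atTop] fun m : ℕ => (m ! : ℝ) * (m + 1 : ℝ) ^ (β - 1) := by
  have hcast : ∀ c : ℝ, (fun m : ℕ => (m : ℝ) + c) =Θ[atTop] fun m : ℕ => (m : ℝ) := fun c => by
    refine IsLittleO.right_isTheta_add' (isLittleO_const_left.2 (Or.inr ?_)) |>.symm
    exact tendsto_norm_atTop_atTop.comp tendsto_natCast_atTop_atTop
  have h1 : (fun m : ℕ => Real.Gamma (m + 1 + β)) =Θ[atTop]
      fun m : ℕ => (m ! : ℝ) * (m : ℝ) ^ β := by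
    refine isTheta_of_div_tendsto_nhds_ne_zero (c := 1) ?_ one_ne_zero
    have h := (GammaSeq_tendsto_Gamma β).div_const (Real.Gamma β)
    rw [div_self (Gamma_pos_of_pos hβ).ne'] at h
    refine h.congr fun m => ?_
    rw [Gamma_nat_add_one_add hβ, GammaSeq, div_div, mul_comm (_ ^ _), mul_comm (Finset.prod _ _)]
  have h2 : (fun m : ℕ => (m : ℝ) ^ (β - 1)) =Θ[atTop] fun m : ℕ => (m + 1 : ℝ) ^ (β - 1) :=
    (hcast 1).symm.rpow (.of_forall fun m => by simp) (.of_forall fun m => by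
      simp only [Pi.zero_apply]; positivity)
  have h3 := (h1.div (hcast β)).trans_eventuallyEq (g₂ := fun m : ℕ => (m ! : ℝ) * (m : ℝ) ^ (β - 1)) (by
    filter_upwards [eventually_gt_atTop 0] with m hm
    rw [rpow_sub_one (by positivity), mul_div_assoc])
  refine (EventuallyEq.trans_isTheta (.of_forall fun m => ?_) h3).trans ((isTheta_refl _ _).mul h2)
  have : (0 : ℝ) < m + β := by positivity
  rw [show (m : ℝ) + 1 + β = m + β + 1 by ring, Real.Gamma_add_one this.ne']
  field_simp

theorem factorial_mul_Gamma_nat_add_half (m : ℕ) :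
    (m ! : ℝ) * Real.Gamma (m + 1 / 2) = (2 * m)! / 4 ^ m * √π := by
  have h := Real.Gamma_mul_Gamma_add_half (m + 1 / 2)
  rw [show (m : ℝ) + 1 / 2 + 1 / 2 = m + 1 by ring, Real.Gamma_nat_eq_factorial,
    show 2 * ((m : ℝ) + 1 / 2) = ((2 * m : ℕ) : ℝ) + 1 by push_cast; ring,
    Real.Gamma_nat_eq_factorial,
    show (1 : ℝ) - (((2 * m : ℕ) : ℝ) + 1) = -((2 * m : ℕ) : ℝ) by ring,
    rpow_neg zero_le_two, rpow_natCast, pow_mul] at h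
  rw [mul_comm, h]
  norm_num [div_eq_mul_inv]

theorem inv_factorial_mul_Gamma_bounds {β : ℝ} (hβ : 0 < β) :
    ∃ c C : ℝ, 0 < c ∧ 0 < C ∧ ∀ m : ℕ,
      c * (4 ^ m / (2 * m)! * (m + 1 : ℝ) ^ (1 / 2 - β)) ≤ 1 / (m ! * Real.Gamma (m + β)) ∧
      1 / (m ! * Real.Gamma (m + β)) ≤ C * (4 ^ m / (2 * m)! * (m + 1 : ℝ) ^ (1 / 2 - β)) := by
  have hf : ∀ m : ℕ, 0 < 1 / (m ! * Real.Gamma (m + β)) := fun m => by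
    have := Gamma_pos_of_pos (show (0 : ℝ) < m + β by positivity)
    positivity
  have hg : ∀ m : ℕ, 0 < 4 ^ m / (2 * m)! * (m + 1 : ℝ) ^ (1 / 2 - β) := fun m => by positivity
  have h : (fun m : ℕ => 1 / (m ! * Real.Gamma (m + β))) =Θ[atTop]
      fun m : ℕ => 4 ^ m / (2 * m)! * (m + 1 : ℝ) ^ (1 / 2 - β) := by
    have h1 := (Gamma_nat_add_isTheta hβ).div (Gamma_nat_add_isTheta (one_half_pos (α := ℝ)))
    have h2 := ((isTheta_refl (fun m : ℕ => 4 ^ m / ((2 * m)! : ℝ)) atTop).div h1)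
    refine (EventuallyEq.trans_isTheta (.of_forall fun m => ?_)
      (h2.const_mul_left (c := (√π)⁻¹) (by positivity))).trans_eventuallyEq
        (.of_forall fun m => ?_)
    · have e := factorial_mul_Gamma_nat_add_half m
      have := Gamma_pos_of_pos (show (0 : ℝ) < m + β by positivity)
      have h3 := Gamma_pos_of_pos (show (0 : ℝ) < m + 1 / 2 by positivity)
      have : Real.Gamma (m + 1 / 2) = (2 * m)! / 4 ^ m * √π / m ! := by
        rw [← e]; field_simp
      simp only [this]
      field_simp
    · have : ((m : ℝ) + 1) ^ (1 / 2 - β) = (m + 1 : ℝ) ^ ((1 : ℝ) / 2 - 1) / (m + 1 : ℝ) ^ (β - 1) := by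
        rw [← rpow_sub (by positivity)]; ring_nf
      simp only [this]
      field_simp
  obtain ⟨C, hC⟩ := (isBigO_nat_atTop_iff fun m hm => absurd hm (hg m).ne').1 h.1
  obtain ⟨D, hD⟩ := (isBigO_nat_atTop_iff fun m hm => absurd hm (hf m).ne').1 h.2
  simp only [Real.norm_of_nonneg (hf _).le, Real.norm_of_nonneg (hg _).le] at hC hD
  have hCpos : 0 < C := pos_of_mul_pos_left ((hf 0).trans_le (hC 0)) (hg 0).le
  have hDpos : 0 < D := pos_of_mul_pos_left ((hg 0).trans_le (hD 0)) (hf 0).le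
  exact ⟨D⁻¹, C, inv_pos.2 hDpos, hCpos, fun m => ⟨(inv_mul_le_iff₀ hDpos).2 (hD m), hC m⟩⟩

theorem hasSum_mul_cosh_term (r : ℝ) :
    HasSum (fun m : ℕ => (2 * r) ^ (2 * m) / (2 * m)! * (m + 1 : ℝ))
      (r * sinh (2 * r) + cosh (2 * r)) := by
  have h : HasSum (fun m : ℕ => (2 * r) ^ (2 * m) / (2 * m)! * (m : ℝ)) (r * sinh (2 * r)) := by
    rw [← hasSum_nat_add_iff' 1]
    simp only [Finset.sum_range_one, Nat.cast_zero, mul_zero, sub_zero]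
    convert! (hasSum_sinh (2 * r)).mul_left r using 2 with m
    rw [show 2 * (m + 1) = 2 * m + 1 + 1 by ring, Nat.factorial_succ (2 * m + 1)]
    push_cast
    field_simp
    ring
  convert! h.add (hasSum_cosh (2 * r)) using 2 with m
  ring

theorem one_sub_mul_le_rpow_neg {γ y : ℝ} (hγ : 0 ≤ γ) (hy : 0 < y) :
    1 + γ - γ * y ≤ y ^ (-γ) := by
  rw [rpow_def_of_pos hy]
  nlinarith [add_one_le_exp (log y * -γ), mul_le_mul_of_nonneg_left (log_le_sub_one_of_pos hy) hγ]

theorem summable_cosh_term_mul_rpow_neg {γ : ℝ} (hγ : 0 ≤ γ) (r : ℝ) :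
    Summable fun m : ℕ => (2 * r) ^ (2 * m) / (2 * m)! * (m + 1 : ℝ) ^ (-γ) := by
  have hw : ∀ m : ℕ, 0 ≤ (2 * r) ^ (2 * m) / (2 * m)! := fun m => by
    rw [pow_mul]; positivity
  refine .of_nonneg_of_le (fun m => mul_nonneg (hw m) (by positivity)) (fun m => ?_)
    (hasSum_cosh (2 * r)).summable
  exact mul_le_of_le_one_right (hw m) (rpow_le_one_of_one_le_of_nonpos (by simp) (by linarith))

theorem exp_mul_rpow_le_tsum_cosh_term {γ r : ℝ} (hγ : 0 ≤ γ) (hr : 0 ≤ r) :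
    1 / 2 * (exp (2 * r) * (1 + r) ^ (-γ)) ≤
      ∑' m : ℕ, (2 * r) ^ (2 * m) / (2 * m)! * (m + 1 : ℝ) ^ (-γ) := by
  have h1 := (((hasSum_cosh (2 * r)).mul_left (1 + γ)).sub
    ((hasSum_mul_cosh_term r).mul_left (γ / (1 + r)))).mul_left ((1 + r) ^ (-γ))
  have h2 := hasSum_le (fun m => ?_) h1 (summable_cosh_term_mul_rpow_neg hγ r).hasSum
  · refine le_trans ?_ h2
    have h3 : sinh (2 * r) ≤ cosh (2 * r) := (sinh_lt_cosh _).le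
    have h4 : exp (2 * r) ≤ 2 * cosh (2 * r) := by
      rw [cosh_eq]; linarith [exp_pos (-(2 * r))]
    have h5 : γ / (1 + r) * (r * sinh (2 * r) + cosh (2 * r)) ≤ γ * cosh (2 * r) := by
      rw [div_mul_eq_mul_div, div_le_iff₀ (by positivity), mul_assoc]
      gcongr
      nlinarith
    have h6 : 0 < (1 + r) ^ (-γ) := by positivity
    nlinarith
  · have h3 := one_sub_mul_le_rpow_neg hγ (show 0 < (m + 1 : ℝ) / (1 + r) by positivity)
    rw [div_rpow (by positivity) (by positivity), le_div_iff₀ (by positivity)] at h3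
    have hw : 0 ≤ (2 * r) ^ (2 * m) / (2 * m)! := by positivity
    refine le_trans (le_of_eq ?_) (mul_le_mul_of_nonneg_left h3 hw)
    ring

theorem pow_mul_cosh_term_div_le {r : ℝ} (hr : 0 ≤ r) (j m : ℕ) :
    (2 * r) ^ (2 * m) / (2 * m)! * (r / (m + 1)) ^ j ≤
      (2 + j) ^ j * ((2 * r) ^ (2 * m + j) / (2 * m + j)!) := by
  have h : ((2 * m + j)! : ℝ) ≤ (2 * m)! * ((2 + j) * (m + 1)) ^ j := by
    rw [← Nat.factorial_mul_ascFactorial]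
    have h1 : (2 * m + 1).ascFactorial j ≤ ((2 + j) * (m + 1)) ^ j :=
      (Nat.ascFactorial_le_pow_add _ _).trans (Nat.pow_le_pow_left (by nlinarith) _)
    exact_mod_cast Nat.mul_le_mul_left _ h1
  rw [div_pow, div_mul_div_comm, ← mul_div_assoc, div_le_div_iff₀ (by positivity) (by positivity)]
  have h2 : r ^ j ≤ (2 * r) ^ j := by gcongr; linarith
  calc _ ≤ (2 * r) ^ (2 * m) * (2 * r) ^ j * ((2 * m)! * ((2 + j) * (m + 1)) ^ j) := by gcongr
    _ = _ := by rw [mul_pow (2 + (j : ℝ)), pow_add]; ring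

theorem tsum_cosh_term_le_exp_mul_rpow {γ : ℝ} (hγ : 0 ≤ γ) :
    ∃ C : ℝ, 0 < C ∧ ∀ r : ℝ, 0 ≤ r →
      ∑' m : ℕ, (2 * r) ^ (2 * m) / (2 * m)! * (m + 1 : ℝ) ^ (-γ) ≤
        C * (exp (2 * r) * (1 + r) ^ (-γ)) := by
  obtain ⟨j, hj⟩ := exists_nat_ge γ
  refine ⟨2 ^ j * (1 + (2 + j) ^ j), by positivity, fun r hr => ?_⟩
  have hexp : HasSum (fun k : ℕ => (2 * r) ^ k / k !) (exp (2 * r)) := by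
    rw [Real.exp_eq_exp_ℝ]; exact NormedSpace.expSeries_div_hasSum_exp (2 * r)
  have hinj : Function.Injective fun m : ℕ => 2 * m + j := fun a b h => by
    simp only at h; omega
  have hs := hexp.summable.comp_injective hinj
  have hle : ∑' m : ℕ, (2 * r) ^ (2 * m + j) / ((2 * m + j)! : ℝ) ≤ exp (2 * r) := by
    rw [← hexp.tsum_eq]
    exact tsum_comp_le_tsum_of_inj hexp.summable (fun k => by positivity) hinj
  have hb := (((hasSum_cosh (2 * r)).add (hs.hasSum.mul_left ((2 + j : ℝ) ^ j))).mul_left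
    ((2 : ℝ) ^ j)).mul_right ((1 + r) ^ (-γ))
  refine (hasSum_le (fun m => ?_) (summable_cosh_term_mul_rpow_neg hγ r).hasSum hb).trans ?_
  · have h1 : (m + 1 : ℝ) ^ (-γ) ≤ 2 ^ j * (1 + (r / (m + 1)) ^ j) * (1 + r) ^ (-γ) := by
      rw [rpow_neg (by positivity), rpow_neg (by positivity), ← div_eq_mul_inv,
        le_div_iff₀ (by positivity), ← div_eq_inv_mul, ← div_rpow (by positivity) (by positivity)]
      set z := r / (m + 1 : ℝ) with hz
      have hz0 : 0 ≤ z := by positivity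
      have hz1 : (1 + r) / (m + 1 : ℝ) ≤ 1 + z := by
        rw [add_div]; gcongr; exact div_le_one_of_le₀ (by simp) (by positivity)
      calc ((1 + r) / (m + 1 : ℝ)) ^ γ ≤ (1 + z) ^ γ := by gcongr
        _ ≤ (1 + z) ^ (j : ℝ) := rpow_le_rpow_of_exponent_le (by linarith) hj
        _ = (1 + z) ^ j := rpow_natCast _ _
        _ ≤ 2 ^ j * (1 + z ^ j) := by
          rcases le_total z 1 with h | h
          · calc (1 + z) ^ j ≤ 2 ^ j := by gcongr; linarith
              _ ≤ _ := le_mul_of_one_le_right (by positivity) (by simp; positivity)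
          · calc (1 + z) ^ j ≤ (2 * z) ^ j := by gcongr; linarith
              _ = 2 ^ j * z ^ j := mul_pow _ _ _
              _ ≤ _ := by gcongr; linarith
    have hw : 0 ≤ (2 * r) ^ (2 * m) / (2 * m)! := by positivity
    refine (mul_le_mul_of_nonneg_left h1 hw).trans ?_
    have h2 := pow_mul_cosh_term_div_le hr j m
    calc _ = 2 ^ j * ((2 * r) ^ (2 * m) / (2 * m)! +
          (2 * r) ^ (2 * m) / (2 * m)! * (r / (m + 1)) ^ j) * (1 + r) ^ (-γ) := by ring
      _ ≤ _ := by
        simp only [Function.comp_apply]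
        gcongr
  · have h4 : cosh (2 * r) ≤ exp (2 * r) := by
      rw [cosh_eq]; linarith [exp_le_exp.2 (show -(2 * r) ≤ 2 * r by linarith)]
    calc _ ≤ 2 ^ j * (exp (2 * r) + (2 + j) ^ j * exp (2 * r)) * (1 + r) ^ (-γ) := by
          gcongr
          exact hle
      _ = _ := by ring

theorem tsum_pow_div_factorial_mul_Gamma_bounds {β : ℝ} (hβ : 1 / 2 ≤ β) :
    ∃ c C : ℝ, 0 < c ∧ 0 < C ∧ ∀ r : ℝ, 0 ≤ r →
      c * (exp (2 * r) * (1 + r) ^ (1 / 2 - β)) ≤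
        ∑' m : ℕ, r ^ (2 * m) / (m ! * Real.Gamma (m + β)) ∧
      ∑' m : ℕ, r ^ (2 * m) / (m ! * Real.Gamma (m + β)) ≤
        C * (exp (2 * r) * (1 + r) ^ (1 / 2 - β)) := by
  obtain ⟨c, C, hc, hC, h⟩ := inv_factorial_mul_Gamma_bounds (show 0 < β by linarith)
  have hγ : 0 ≤ β - 1 / 2 := by linarith
  obtain ⟨D, hD, hup⟩ := tsum_cosh_term_le_exp_mul_rpow hγ
  refine ⟨c * (1 / 2), C * D, by positivity, by positivity, fun r hr => ?_⟩
  have hsum := summable_cosh_term_mul_rpow_neg hγ r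
  have hlo := exp_mul_rpow_le_tsum_cosh_term hγ hr
  have hup := hup r hr
  rw [neg_sub] at hsum hlo hup
  have e : ∀ m : ℕ, (2 * r) ^ (2 * m) / (2 * m)! * (m + 1 : ℝ) ^ (1 / 2 - β) =
      r ^ (2 * m) * (4 ^ m / (2 * m)! * (m + 1 : ℝ) ^ (1 / 2 - β)) := fun m => by
    rw [mul_pow, pow_mul 2]; norm_num; ring
  have h1 : ∀ m : ℕ, c * ((2 * r) ^ (2 * m) / (2 * m)! * (m + 1 : ℝ) ^ (1 / 2 - β)) ≤
      r ^ (2 * m) / (m ! * Real.Gamma (m + β)) := fun m => by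
    rw [e, mul_left_comm, div_eq_mul_one_div (r ^ _)]
    exact mul_le_mul_of_nonneg_left (h m).1 (by positivity)
  have h2 : ∀ m : ℕ, r ^ (2 * m) / (m ! * Real.Gamma (m + β)) ≤
      C * ((2 * r) ^ (2 * m) / (2 * m)! * (m + 1 : ℝ) ^ (1 / 2 - β)) := fun m => by
    rw [e, mul_left_comm, div_eq_mul_one_div (r ^ _)]
    exact mul_le_mul_of_nonneg_left (h m).2 (by positivity)
  have hs : Summable fun m : ℕ => r ^ (2 * m) / (m ! * Real.Gamma (m + β)) :=
    .of_nonneg_of_le (fun m => le_trans (by positivity) (h1 m)) h2 (hsum.mul_left C)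
  rw [mul_assoc, mul_assoc]
  exact ⟨(mul_le_mul_of_nonneg_left hlo hc.le).trans
      (hasSum_le h1 (hsum.hasSum.mul_left c) hs.hasSum),
    (hasSum_le h2 hs.hasSum (hsum.hasSum.mul_left C)).trans
      (mul_le_mul_of_nonneg_left hup hC.le)⟩

theorem rpow_le_rpow_abs_of_mem_Icc {b x : ℝ} (hb : 0 < b) (hx : b⁻¹ ≤ x) (hx' : x ≤ b) (p : ℝ) :
    x ^ p ≤ b ^ |p| := by
  have hx0 : 0 < x := (inv_pos.2 hb).trans_le hx
  have h1 : |log x| ≤ log b := abs_le.2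
    ⟨by rw [← log_inv]; exact log_le_log (inv_pos.2 hb) hx, log_le_log hx0 hx'⟩
  rw [rpow_def_of_pos hx0, rpow_def_of_pos hb, exp_le_exp]
  calc log x * p ≤ |log x| * |p| := by rw [← abs_mul]; exact le_abs_self _
    _ ≤ _ := by gcongr

theorem rpow_le_rpow_abs_mul_rpow {b x y : ℝ} (hb : 0 < b) (hx : 0 < x) (hy : 0 < y)
    (hxy : x ≤ b * y) (hyx : y ≤ b * x) (p : ℝ) : x ^ p ≤ b ^ |p| * y ^ p := by
  have h := rpow_le_rpow_abs_of_mem_Icc (x := x / y) hb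
    (by rw [le_div_iff₀ hy, inv_mul_le_iff₀ hb]; exact hyx) (by rwa [div_le_iff₀ hy]) p
  rwa [div_rpow hx.le hy.le, div_le_iff₀ (by positivity)] at h

theorem sq_le_two_mul_cosh_sub_two (x : ℝ) : x ^ 2 ≤ 2 * cosh x - 2 := by
  have h1 : |x / 2| ≤ sinh |x / 2| := self_le_sinh_iff.2 (abs_nonneg _)
  have h2 : (x / 2) ^ 2 ≤ sinh (x / 2) ^ 2 := by
    rw [← sq_abs (x / 2), ← sq_abs (sinh (x / 2)), abs_sinh]
    gcongr
  have h3 := cosh_two_mul (x / 2)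
  rw [cosh_sq, mul_div_cancel₀ x two_ne_zero] at h3
  linarith

theorem two_mul_cosh_sub_two_le {x : ℝ} (hx : |x| ≤ 1) : 2 * cosh x - 2 ≤ 2 * x ^ 2 := by
  have h0 : x ^ 2 ≤ 1 := (sq_le_one_iff_abs_le_one x).2 hx
  have h1 := (abs_le.1 (abs_exp_sub_one_sub_id_le (x := x ^ 2 / 2) (by
    rw [abs_of_nonneg (by positivity)]; linarith))).2
  nlinarith [cosh_le_exp_half_sq x, sq_nonneg x]

/-- The integrand of `G s (2 * a)` after the substitution `t = a * exp (v / √a)`, stripped of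
the factor `exp (-2 * a) * a ^ (s - 1 / 2)`. -/
noncomputable def saddleIntegrand (s a v : ℝ) : ℝ :=
  exp (-(a * (2 * cosh (v / √a) - 2)) + s * (v / √a))

theorem G_two_mul (s : ℝ) {a : ℝ} (ha : 0 < a) :
    G s (2 * a) = exp (-(2 * a)) * a ^ (s - 1 / 2) * ∫ v, saddleIntegrand s a v := by
  have hsq : 0 < √a := sqrt_pos.2 ha
  have himg : (fun v : ℝ => a * exp (v / √a)) '' univ = Ioi 0 := by
    ext t
    simp only [image_univ, mem_range, mem_Ioi]
    refine ⟨fun ⟨v, hv⟩ => hv ▸ by positivity, fun ht => ⟨√a * log (t / a), ?_⟩⟩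
    rw [mul_div_cancel_left₀ _ hsq.ne', exp_log (by positivity), mul_div_cancel₀ _ ha.ne']
  have hder : ∀ v ∈ univ, HasDerivWithinAt (fun v : ℝ => a * exp (v / √a))
      (a * (exp (v / √a) * (1 / √a))) univ v := fun v _ =>
    ((((hasDerivAt_id v).div_const (√a)).exp).const_mul a).hasDerivWithinAt
  have hinj : InjOn (fun v : ℝ => a * exp (v / √a)) univ := fun u _ v _ h => by
    have := exp_injective (mul_left_cancel₀ ha.ne' h)
    exact (div_left_inj' hsq.ne').1 this
  rw [G, ← himg, integral_image_eq_integral_abs_deriv_smul MeasurableSet.univ hder hinj,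
    setIntegral_univ, ← integral_const_mul]
  refine integral_congr_ae (.of_forall fun v => ?_)
  simp only [saddleIntegrand, smul_eq_mul]
  set x := v / √a
  have h1 : |a * (exp x * (1 / √a))| = √a * exp x := by
    rw [abs_of_nonneg (by positivity)]
    field_simp
    rw [sq_sqrt ha.le]
  have h2 : (a * exp x) ^ (s - 1) = a ^ (s - 1) * exp (x * (s - 1)) := by
    rw [mul_rpow ha.le (exp_pos _).le, ← exp_mul]
  have h3 : a ^ (s - 1 / 2) = √a * a ^ (s - 1) := by
    rw [sqrt_eq_rpow, ← rpow_add ha]; ring_nf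
  have h4 : -(a * exp x) - (2 * a) ^ 2 / (4 * (a * exp x)) = -(a * (2 * cosh x)) := by
    rw [cosh_eq, exp_neg]; field_simp; ring
  rw [h1, h2, h3, h4]
  calc _ = √a * a ^ (s - 1) * (exp x * exp (-(a * (2 * cosh x))) * exp (x * (s - 1))) := by ring
    _ = √a * a ^ (s - 1) * (exp (-(2 * a)) * exp (-(a * (2 * cosh x - 2)) + s * x)) := by
      rw [← exp_add, ← exp_add, ← exp_add]; ring_nf
    _ = _ := by ring

theorem saddleIntegrand_le (s : ℝ) {a : ℝ} (ha : 1 ≤ a) (v : ℝ) :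
    saddleIntegrand s a v ≤ exp (s ^ 2 / 2) * exp (-(1 / 2) * v ^ 2) := by
  have ha0 : 0 < a := by linarith
  have hx : a * (v / √a) ^ 2 = v ^ 2 := by
    rw [div_pow, sq_sqrt ha0.le]; field_simp
  rw [saddleIntegrand, ← exp_add, exp_le_exp]
  nlinarith [mul_le_mul_of_nonneg_left (sq_le_two_mul_cosh_sub_two (v / √a)) ha0.le,
    sq_nonneg (s - v / √a), mul_le_mul_of_nonneg_right ha (sq_nonneg (v / √a))]

theorem integrable_saddleIntegrand (s : ℝ) {a : ℝ} (ha : 1 ≤ a) :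
    Integrable (saddleIntegrand s a) := by
  refine ((integrable_exp_neg_mul_sq (one_half_pos (α := ℝ))).const_mul (exp (s ^ 2 / 2))).mono'
    ?_ (.of_forall fun v => ?_)
  · unfold saddleIntegrand
    exact Continuous.aestronglyMeasurable (by fun_prop)
  · have h0 : 0 ≤ saddleIntegrand s a v := (exp_pos _).le
    rw [Real.norm_of_nonneg h0]
    exact saddleIntegrand_le s ha v

theorem integral_saddleIntegrand_le (s : ℝ) {a : ℝ} (ha : 1 ≤ a) :
    ∫ v, saddleIntegrand s a v ≤ exp (s ^ 2 / 2) * √(π / (1 / 2)) := by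
  rw [← integral_gaussian, ← integral_const_mul]
  exact integral_mono (integrable_saddleIntegrand s ha)
    ((integrable_exp_neg_mul_sq (one_half_pos (α := ℝ))).const_mul _) (saddleIntegrand_le s ha)

theorem exp_neg_two_le_integral_saddleIntegrand {s a : ℝ} (hs : 0 ≤ s) (ha : 1 ≤ a) :
    exp (-2) ≤ ∫ v, saddleIntegrand s a v := by
  have ha0 : 0 < a := by linarith
  have hI := integrable_saddleIntegrand s ha
  calc exp (-2) = ∫ _ in Icc (0 : ℝ) 1, exp (-2) := by simp
    _ ≤ ∫ v in Icc (0 : ℝ) 1, saddleIntegrand s a v := by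
      refine setIntegral_mono_on (by simp) hI.integrableOn measurableSet_Icc fun v hv => ?_
      have hx0 : 0 ≤ v / √a := div_nonneg hv.1 (sqrt_nonneg _)
      have hx1 : v / √a ≤ 1 := div_le_one_of_le₀ (hv.2.trans (one_le_sqrt.2 ha)) (sqrt_nonneg _)
      have hx : a * (v / √a) ^ 2 = v ^ 2 := by
        rw [div_pow, sq_sqrt ha0.le]; field_simp
      rw [saddleIntegrand, exp_le_exp]
      nlinarith [mul_le_mul_of_nonneg_left
        (two_mul_cosh_sub_two_le (abs_le.2 ⟨by linarith, hx1⟩)) ha0.le, mul_nonneg hs hx0,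
        pow_le_one₀ (n := 2) hv.1 hv.2]
    _ ≤ ∫ v, saddleIntegrand s a v :=
      setIntegral_le_integral hI (.of_forall fun v => (exp_pos _).le)

theorem integrableOn_G_integrand {s : ℝ} (hs : 0 < s) (r : ℝ) :
    IntegrableOn (fun t => exp (-t - r ^ 2 / (4 * t)) * t ^ (s - 1)) (Ioi 0) := by
  refine (GammaIntegral_convergent hs).mono' (by fun_prop) ?_
  refine (ae_restrict_iff' measurableSet_Ioi).2 (.of_forall fun t ht => ?_)
  have ht : 0 < t := ht
  rw [Real.norm_of_nonneg (by positivity)]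
  gcongr
  have : 0 ≤ r ^ 2 / (4 * t) := by positivity
  linarith

theorem G_antitone {s : ℝ} (hs : 0 < s) {r₁ r₂ : ℝ} (h₁ : 0 ≤ r₁) (h : r₁ ≤ r₂) :
    G s r₂ ≤ G s r₁ := by
  refine setIntegral_mono_on (integrableOn_G_integrand hs r₂) (integrableOn_G_integrand hs r₁)
    measurableSet_Ioi fun t ht => ?_
  have ht : 0 < t := ht
  gcongr

theorem G_zero {s : ℝ} (hs : 0 < s) : G s 0 = Real.Gamma s := by
  simp [G, Real.Gamma_eq_integral hs]

theorem G_bounds {s : ℝ} (hs : 0 < s) :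
    ∃ c C : ℝ, 0 < c ∧ 0 < C ∧ ∀ r : ℝ, 0 ≤ r →
      c * (exp (-r) * (1 + r) ^ (s - 1 / 2)) ≤ G s r ∧
      G s r ≤ C * (exp (-r) * (1 + r) ^ (s - 1 / 2)) := by
  set p := s - 1 / 2
  set B : ℝ := 3 ^ |p|
  have hB : 0 < B := by positivity
  set M := exp (s ^ 2 / 2) * √(π / (1 / 2))
  have hΓ := Real.Gamma_pos_of_pos hs
  refine ⟨B⁻¹ * exp (-4), B * (M + Real.Gamma s * exp 2), by positivity, by positivity,
    fun r hr => ?_⟩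
  have hE : 0 < exp (-r) := exp_pos _
  have hP : 0 < (1 + r) ^ p := by positivity
  rw [mul_assoc, inv_mul_le_iff₀ hB]
  rcases le_total r 2 with h | h
  · constructor
    · have h1 : exp (-4) ≤ G s r := by
        refine le_trans ?_ (G_antitone hs hr h)
        have h2 := G_two_mul s one_pos
        rw [mul_one, one_rpow, mul_one] at h2
        rw [h2, show (-4 : ℝ) = -2 + -2 by norm_num, exp_add]
        gcongr
        exact exp_neg_two_le_integral_saddleIntegrand hs.le le_rfl
      have h3 : (1 + r) ^ p ≤ B :=
        rpow_le_rpow_abs_of_mem_Icc three_pos (by norm_num; linarith) (by linarith) p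
      have h4 : exp (-r) ≤ 1 := exp_le_one_iff.2 (by linarith)
      have h5 : 0 ≤ G s r := (exp_pos _).le.trans h1
      calc exp (-4) * (exp (-r) * (1 + r) ^ p) ≤ G s r * (1 * B) := by gcongr
        _ = _ := by ring
    · have h1 : G s r ≤ Real.Gamma s := G_zero hs ▸ G_antitone hs le_rfl hr
      have h3 : 1 ≤ B * (1 + r) ^ p := by
        simpa using rpow_le_rpow_abs_mul_rpow (x := 1) (y := 1 + r) three_pos one_pos
          (by linarith) (by linarith) (by linarith) p
      have h4 : 1 ≤ exp 2 * exp (-r) := by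
        rw [← exp_add]; exact one_le_exp (by linarith)
      calc G s r ≤ Real.Gamma s * (exp 2 * exp (-r)) * (B * (1 + r) ^ p) :=
            h1.trans (by
              rw [mul_assoc]
              exact le_mul_of_one_le_right hΓ.le (one_le_mul_of_one_le_of_one_le h4 h3))
        _ = B * (Real.Gamma s * exp 2) * (exp (-r) * (1 + r) ^ p) := by ring
        _ ≤ _ := by
          gcongr
          have : 0 ≤ M := by positivity
          linarith
  · have ha : 1 ≤ r / 2 := by linarith
    have h2 := G_two_mul s (show 0 < r / 2 by linarith)
    rw [mul_div_cancel₀ r two_ne_zero] at h2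
    have hlo := exp_neg_two_le_integral_saddleIntegrand hs.le ha
    have hup := integral_saddleIntegrand_le s ha
    set I := ∫ v, saddleIntegrand s (r / 2) v
    have hI : 0 < I := (exp_pos _).trans_le hlo
    have h42 : exp (-4) ≤ I := (exp_le_exp.2 (by norm_num)).trans hlo
    rw [h2]
    constructor
    · have h3 : (1 + r) ^ p ≤ B * (r / 2) ^ p :=
        rpow_le_rpow_abs_mul_rpow three_pos (by linarith) (by linarith) (by linarith)
          (by linarith) p
      calc exp (-4) * (exp (-r) * (1 + r) ^ p) ≤ I * (exp (-r) * (B * (r / 2) ^ p)) := by gcongr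
        _ = _ := by ring
    · have h3 : (r / 2) ^ p ≤ B * (1 + r) ^ p :=
        rpow_le_rpow_abs_mul_rpow three_pos (by linarith) (by linarith) (by linarith)
          (by linarith) p
      calc exp (-r) * (r / 2) ^ p * I ≤ exp (-r) * (B * (1 + r) ^ p) * M := by gcongr
        _ = B * M * (exp (-r) * (1 + r) ^ p) := by ring
        _ ≤ _ := by
          gcongr
          have : 0 ≤ Real.Gamma s * exp 2 := by positivity
          linarith

end

/-- Global two-sided bounds: `G(r)² S(r) ≍ (1+r)^{2s - α - (n+1)/2}` on `(0,∞)`. -/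
theorem stmt16 (n : ℕ) (hn : 1 ≤ n) (s : ℝ) (hs : 0 < s) (α : ℝ) (hα : 0 < α) :
    ∃ c₁ c₂ : ℝ, 0 < c₁ ∧ c₁ ≤ c₂ ∧
      ∀ r : ℝ, 0 < r →
        c₁ * (1 + r) ^ (2 * s - α - ((n : ℝ) + 1) / 2) ≤ G s r ^ 2 * S n α r ∧
          G s r ^ 2 * S n α r ≤ c₂ * (1 + r) ^ (2 * s - α - ((n : ℝ) + 1) / 2) := by
  have hn' : (1 : ℝ) ≤ n := by exact_mod_cast hn
  obtain ⟨c, C, hc, hC, hG⟩ := G_bounds hs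
  obtain ⟨d, D, hd, hD, hS⟩ :=
    tsum_pow_div_factorial_mul_Gamma_bounds (β := α + n / 2) (by linarith)
  have key : ∀ r : ℝ, 0 < r → c ^ 2 * d * (1 + r) ^ (2 * s - α - ((n : ℝ) + 1) / 2) ≤
      G s r ^ 2 * S n α r ∧
      G s r ^ 2 * S n α r ≤ C ^ 2 * D * (1 + r) ^ (2 * s - α - ((n : ℝ) + 1) / 2) := by
    intro r hr
    obtain ⟨hG1, hG2⟩ := hG r hr.le
    obtain ⟨hS1, hS2⟩ := hS r hr.le
    simp only [← add_assoc] at hS1 hS2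
    change _ ≤ S n α r at hS1
    change S n α r ≤ _ at hS2
    have hr1 : 0 < 1 + r := by linarith
    have hE : exp (-r) ^ 2 * exp (2 * r) = 1 := by
      rw [← exp_nat_mul, ← exp_add]; simp
    have hP : ((1 + r) ^ (s - 1 / 2)) ^ 2 * (1 + r) ^ (1 / 2 - (α + n / 2)) =
        (1 + r) ^ (2 * s - α - ((n : ℝ) + 1) / 2) := by
      rw [← rpow_mul_natCast hr1.le, ← rpow_add hr1]
      push_cast
      ring_nf
    have hprod : ∀ x y : ℝ, (x * (exp (-r) * (1 + r) ^ (s - 1 / 2))) ^ 2 *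
        (y * (exp (2 * r) * (1 + r) ^ (1 / 2 - (α + n / 2)))) =
        x ^ 2 * y * (1 + r) ^ (2 * s - α - ((n : ℝ) + 1) / 2) := fun x y => by
      rw [← hP]
      linear_combination (x ^ 2 * y * (((1 + r) ^ (s - 1 / 2)) ^ 2 *
        (1 + r) ^ (1 / 2 - (α + n / 2)))) * hE
    have hG0 : 0 ≤ G s r := le_trans (by positivity) hG1
    have hS0 : 0 ≤ S n α r := le_trans (by positivity) hS1
    rw [← hprod, ← hprod]
    constructor <;> gcongr
  refine ⟨c ^ 2 * d, C ^ 2 * D, by positivity, ?_, key⟩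
  have h := (key 1 one_pos).1.trans (key 1 one_pos).2
  exact le_of_mul_le_mul_right h (by positivity)
end
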